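/- arXiv:2501.12513 — 3 statements merged into one kernel-verified Lean document; each statement's English description precedes it below -/
import Mathlib

section
/- (Stanley's Shuffling Theorem) Let π and σ be sequences of distinct values (words) on disjoint value sets whose union is [m+n], with π of length m and σ of length n. Then the sum of q^{maj(τ)} over all shuffles τ of π and σ (permutations of [m+n] containing both π and σ as subsequences) equals q^{maj(π)+maj(σ)} · [m+n]_q! / ([m]_q! [n]_q!). -/
/-- The major index of a word `w` of length `N`. -/
def wmaj {N : ℕ} {α : Type*} [LinearOrder α] (w : Fin N → α) : ℕ :=
  ∑ i ∈ Finset.range (N - 1),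
    if h : i + 1 < N then
      (if w ⟨i + 1, h⟩ < w ⟨i, Nat.lt_of_succ_lt h⟩ then i + 1 else 0)
    else 0

/-- The `q`-integer `[m]_q = 1 + q + ⋯ + q^{m-1}`. -/
def qint (q : ℝ) (m : ℕ) : ℝ := ∑ j ∈ Finset.range m, q ^ j

/-- The `q`-factorial `[n]_q! = ∏_{i=1}^n [i]_q`. -/
def qfact (q : ℝ) (n : ℕ) : ℝ := ∏ i ∈ Finset.range n, qint q (i + 1)

/-- `w` appears as a subsequence of the word `τ`. -/
def IsSubseqOf {k N : ℕ} {α : Type*} (w : Fin k → α) (τ : Fin N → α) : Prop :=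
  ∃ f : Fin k → Fin N, StrictMono f ∧ ∀ i, τ (f i) = w i

/-- `τ` is a shuffle of the words `p` and `s`. -/
def IsShuffle {m n : ℕ} (p : Fin m → Fin (m + n)) (s : Fin n → Fin (m + n))
    (τ : Equiv.Perm (Fin (m + n))) : Prop :=
  IsSubseqOf p (fun i => τ i) ∧ IsSubseqOf s (fun i => τ i)

/-- Compatibility of a labelling `g` with a word `w` (P-partition condition). -/
def Compat {N : ℕ} {α : Type*} [LinearOrder α] (w : Fin N → α) (g : Fin N → ℕ) : Prop :=
  ∀ (i : ℕ) (h : i + 1 < N),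
    g ⟨i + 1, h⟩ + (if w ⟨i + 1, h⟩ < w ⟨i, Nat.lt_of_succ_lt h⟩ then 1 else 0)
      ≤ g ⟨i, Nat.lt_of_succ_lt h⟩

/-- The sorting key. -/
def skey {α : Type*} (a : ℕ) (v : α) : ℕᵒᵈ ×ₗ α := toLex (OrderDual.toDual a, v)

theorem skey_lt {α : Type*} [LinearOrder α] (a b : ℕ) (u v : α) :
    skey a u < skey b v ↔ b < a ∨ (a = b ∧ u < v) := by
  simp [skey, Prod.Lex.toLex_lt_toLex]

theorem compat_iff {N : ℕ} {α : Type*} [LinearOrder α] (w : Fin N → α)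
    (hw : Function.Injective w) (g : Fin N → ℕ) :
    Compat w g ↔ StrictMono (fun i => skey (g i) (w i)) := by
  cases N with
  | zero => exact ⟨fun _ i => i.elim0, fun _ i h => absurd h (by omega)⟩
  | succ N =>
    rw [Fin.strictMono_iff_lt_succ]
    have key : ∀ (i : ℕ) (h : i + 1 < N + 1),
        (g ⟨i + 1, h⟩ + (if w ⟨i + 1, h⟩ < w ⟨i, Nat.lt_of_succ_lt h⟩ then 1 else 0)
          ≤ g ⟨i, Nat.lt_of_succ_lt h⟩) ↔
        skey (g ⟨i, Nat.lt_of_succ_lt h⟩) (w ⟨i, Nat.lt_of_succ_lt h⟩)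
          < skey (g ⟨i + 1, h⟩) (w ⟨i + 1, h⟩) := by
      intro i h
      rw [skey_lt]
      have hne : w ⟨i + 1, h⟩ ≠ w ⟨i, Nat.lt_of_succ_lt h⟩ := by
        intro e
        have := hw e
        simp at this
      rcases lt_or_gt_of_ne hne with h1 | h1
      · simp only [h1, if_true, not_lt_of_gt h1, and_false, or_false]; omega
      · simp only [h1, if_neg (not_lt_of_gt h1), and_true]; omega
    constructor
    · intro H i
      exact (key i.1 (by omega)).1 (H i.1 (by omega))
    · intro H i h
      exact (key i h).2 (H ⟨i, by omega⟩)

/-- Last descent indicator. -/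
def ldesc {k : ℕ} {α : Type*} [LinearOrder α] (w : Fin (k + 1) → α) : ℕ :=
  if h : 0 < k then (if w ⟨k, by omega⟩ < w ⟨k - 1, by omega⟩ then 1 else 0) else 0

theorem wmaj_succ {k : ℕ} {α : Type*} [LinearOrder α] (w : Fin (k + 1) → α) :
    wmaj w = wmaj (fun i : Fin k => w i.castSucc) + k * ldesc w := by
  cases k with
  | zero => simp [wmaj]
  | succ k =>
    unfold wmaj ldesc
    simp only [Nat.add_sub_cancel]
    rw [Finset.sum_range_succ]
    congr 1
    · apply Finset.sum_congr rfl
      intro i hi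
      rw [Finset.mem_range] at hi
      rw [dif_pos (by omega), dif_pos (by omega)]
      rfl
    · rw [dif_pos (by omega), dif_pos (by omega)]
      simp

/-- Build a labelling from its last value and the reduced labelling. -/
def build {k : ℕ} (d : ℕ) (x : ℕ × (Fin k → ℕ)) : Fin (k + 1) → ℕ :=
  Fin.snoc (fun i => x.2 i + x.1 + d) x.1

theorem build_lt {k d : ℕ} (x : ℕ × (Fin k → ℕ)) (i : ℕ) (h : i < k) (h' : i < k + 1) :
    build d x ⟨i, h'⟩ = x.2 ⟨i, h⟩ + x.1 + d := by
  have : (⟨i, h'⟩ : Fin (k + 1)) = Fin.castSucc ⟨i, h⟩ := rfl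
  rw [this, build, Fin.snoc_castSucc]

theorem build_last {k d : ℕ} (x : ℕ × (Fin k → ℕ)) (h' : k < k + 1) :
    build d x ⟨k, h'⟩ = x.1 := by
  have : (⟨k, h'⟩ : Fin (k + 1)) = Fin.last k := rfl
  rw [this, build, Fin.snoc_last]

theorem build_inj {k d : ℕ} : Function.Injective (build (k := k) d) := by
  intro x y h
  have h1 : x.1 = y.1 := by
    have := congrFun h ⟨k, by omega⟩
    rwa [build_last, build_last] at this
  refine Prod.ext h1 (funext fun i => ?_)
  have := congrFun h ⟨i.1, by omega⟩
  rw [build_lt _ _ i.2, build_lt _ _ i.2] at this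
  simp only [Fin.eta] at this
  omega

theorem build_compat {k : ℕ} {α : Type*} [LinearOrder α] (w : Fin (k + 1) → α)
    (x : ℕ × (Fin k → ℕ)) :
    Compat w (build (ldesc w) x) ↔ Compat (fun i : Fin k => w i.castSucc) x.2 := by
  constructor
  · intro H i h
    have := H i (by omega)
    rw [build_lt _ _ h, build_lt _ _ (by omega)] at this
    simp only [Fin.castSucc_mk]
    omega
  · intro H i h
    by_cases hi : i + 1 < k
    · have := H i hi
      rw [build_lt _ _ hi, build_lt _ _ (by omega)]
      simp only [Fin.castSucc_mk] at this
      omega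
    · obtain rfl : k = i + 1 := by omega
      rw [build_last, build_lt _ _ (by omega)]
      unfold ldesc
      rw [dif_pos (by omega)]
      simp only [Nat.add_sub_cancel]
      omega

theorem build_sum {k d : ℕ} (x : ℕ × (Fin k → ℕ)) :
    ∑ i, build d x i = (∑ i, x.2 i) + (k + 1) * x.1 + k * d := by
  rw [Fin.sum_univ_castSucc]
  simp only [build, Fin.snoc_castSucc, Fin.snoc_last, Finset.sum_add_distrib]
  simp
  ring

theorem compat_anti {N : ℕ} {α : Type*} [LinearOrder α] {w : Fin N → α} {g : Fin N → ℕ}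
    (H : Compat w g) (i j : ℕ) (hij : i ≤ j) (hj : j < N) : g ⟨j, hj⟩ ≤ g ⟨i, by omega⟩ := by
  induction j, hij using Nat.le_induction with
  | base => exact le_rfl
  | succ j hij ih =>
    exact le_trans (le_trans (Nat.le_add_right _ _) (H j hj)) (ih (by omega))

theorem compat_mem_range {k : ℕ} {α : Type*} [LinearOrder α] (w : Fin (k + 1) → α)
    (g : Fin (k + 1) → ℕ) (H : Compat w g) : g ∈ Set.range (build (k := k) (ldesc w)) := by
  refine ⟨(g (Fin.last k), fun i => g i.castSucc - g (Fin.last k) - ldesc w), ?_⟩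
  funext i
  induction i using Fin.lastCases with
  | last => simp [build]
  | cast i =>
    simp only [build, Fin.snoc_castSucc]
    have : g (Fin.last k) + ldesc w ≤ g i.castSucc := by
      obtain ⟨i, hi⟩ := i
      obtain ⟨j, rfl⟩ : ∃ j, k = j + 1 := ⟨k - 1, by omega⟩
      have h1 := H j (by omega)
      have h2 := compat_anti H i j (by omega) (by omega)
      unfold ldesc
      rw [dif_pos (by omega)]
      simp only [Nat.add_sub_cancel]
      exact le_trans h1 h2
    omega

open scoped ENNReal

open Classical in
/-- Generating function of compatible labellings. -/
noncomputable def genf (Q : ℝ≥0∞) {N : ℕ} {α : Type*} [LinearOrder α] (w : Fin N → α) : ℝ≥0∞ :=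
  ∑' g : Fin N → ℕ, if Compat w g then Q ^ (∑ i, g i) else 0

/-- The product of geometric series. -/
noncomputable def geo (Q : ℝ≥0∞) (N : ℕ) : ℝ≥0∞ := ∏ i ∈ Finset.range N, (1 - Q ^ (i + 1))⁻¹

theorem genf_eq (Q : ℝ≥0∞) {N : ℕ} {α : Type*} [LinearOrder α] (w : Fin N → α) :
    genf Q w = Q ^ wmaj w * geo Q N := by
  classical
  induction N with
  | zero =>
    have : ∀ g, Compat w g := fun g i h => absurd h (by omega)
    simp [genf, geo, wmaj, this]
  | succ k ih =>
    have hs : Function.support (fun g : Fin (k + 1) → ℕ =>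
        if Compat w g then Q ^ (∑ i, g i) else 0) ⊆ Set.range (build (k := k) (ldesc w)) := by
      intro g hg
      apply compat_mem_range
      by_contra hc
      simp [hc] at hg
    unfold genf
    rw [← build_inj.tsum_eq hs]
    have e : ∀ x : ℕ × (Fin k → ℕ),
        (if Compat w (build (ldesc w) x) then Q ^ (∑ i, build (ldesc w) x i) else 0)
        = Q ^ (k * ldesc w) * ((Q ^ (k + 1)) ^ x.1 *
          (if Compat (fun i : Fin k => w i.castSucc) x.2 then Q ^ (∑ i, x.2 i) else 0)) := by
      intro x
      rw [build_sum]
      by_cases h : Compat (fun i : Fin k => w i.castSucc) x.2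
      · rw [if_pos h, if_pos ((build_compat w x).2 h)]
        ring
      · rw [if_neg h, if_neg (fun h' => h ((build_compat w x).1 h'))]
        simp
    rw [tsum_congr e, ENNReal.tsum_mul_left,
      ENNReal.summable.tsum_prod' (fun _ => ENNReal.summable)]
    simp only [ENNReal.tsum_mul_left, ENNReal.tsum_mul_right, ENNReal.tsum_geometric]
    have := ih (fun i : Fin k => w i.castSucc)
    unfold genf at this
    rw [this, wmaj_succ, geo, geo, Finset.prod_range_succ]
    ring

theorem exists_unique_sort {N : ℕ} (f : Fin N → ℕ) :
    ∃! τ : Equiv.Perm (Fin N), Compat (fun i => τ i) (fun i => f (τ i)) := by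
  have hinj : Function.Injective (fun v : Fin N => skey (f v) v) := by
    intro u v h
    simp only [skey, toLex_inj, Prod.mk.injEq] at h
    exact h.2
  refine ⟨Tuple.sort (fun v : Fin N => skey (f v) v), ?_, ?_⟩
  · simp only
    rw [compat_iff _ (Equiv.injective _)]
    exact (Tuple.monotone_sort (fun v : Fin N => skey (f v) v)).strictMono_of_injective
      (hinj.comp (Equiv.injective _))
  · intro τ h
    rw [compat_iff _ (Equiv.injective _)] at h
    have h2 := (Tuple.monotone_sort (fun v : Fin N => skey (f v) v)).strictMono_of_injective
      (hinj.comp (Equiv.injective _))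
    have := (StrictMono.range_inj h h2).1 (by
      rw [(Equiv.surjective _).range_comp]
      exact τ.surjective.range_comp (fun v : Fin N => skey (f v) v))
    ext1 i
    exact hinj (congrFun this i)

theorem subseq_iff {N k : ℕ} (f : Fin N → ℕ) (τ : Equiv.Perm (Fin N))
    (h : Compat (fun i => τ i) (fun i => f (τ i))) (p : Fin k → Fin N)
    (hp : Function.Injective p) :
    IsSubseqOf p (fun i => τ i) ↔ Compat p (fun i => f (p i)) := by
  rw [compat_iff _ τ.injective] at h
  rw [compat_iff _ hp]
  constructor
  · rintro ⟨F, hF, he⟩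
    have := h.comp hF
    intro i j hij
    have := this hij
    simpa only [Function.comp, he] using this
  · intro H
    refine ⟨fun i => τ.symm (p i), fun i j hij => ?_, fun i => by simp⟩
    rw [← h.lt_iff_lt]
    simpa using H hij

open Finset Classical in
theorem shuffle_enn (Q : ℝ≥0∞) (m n : ℕ)
    (p : Fin m → Fin (m + n)) (s : Fin n → Fin (m + n))
    (hps : Function.Bijective (Sum.elim p s)) :
    (∑ τ ∈ univ.filter (fun τ : Equiv.Perm (Fin (m + n)) => IsShuffle p s τ),
        Q ^ wmaj (fun i => τ i)) * geo Q (m + n)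
      = Q ^ (wmaj p + wmaj s) * (geo Q m * geo Q n) := by
  have hp : Function.Injective p := fun a b h => by
    simpa using @hps.1 (Sum.inl a) (Sum.inl b) h
  have hs : Function.Injective s := fun a b h => by
    simpa using @hps.1 (Sum.inr a) (Sum.inr b) h
  have hR : Q ^ (wmaj p + wmaj s) * (geo Q m * geo Q n) = genf Q p * genf Q s := by
    rw [genf_eq, genf_eq]; ring
  rw [hR, Finset.sum_mul]
  simp only [← genf_eq]
  have h1 : ∀ τ : Equiv.Perm (Fin (m + n)), genf Q (fun i => τ i) =
      ∑' f : Fin (m + n) → ℕ,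
        if Compat (fun i => τ i) (fun i => f (τ i)) then Q ^ (∑ v, f v) else 0 := by
    intro τ
    unfold genf
    rw [← (τ.symm.arrowCongr (Equiv.refl ℕ)).tsum_eq]
    refine tsum_congr fun f => ?_
    have : (τ.symm.arrowCongr (Equiv.refl ℕ)) f = fun i => f (τ i) := by
      funext i; simp [Equiv.arrowCongr]
    rw [this, Equiv.sum_comp τ f]
  simp only [h1]
  rw [← Summable.tsum_finsetSum (fun _ _ => ENNReal.summable)]
  have h2 : ∀ f : Fin (m + n) → ℕ,
      (∑ τ ∈ univ.filter (fun τ : Equiv.Perm (Fin (m + n)) => IsShuffle p s τ),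
        if Compat (fun i => τ i) (fun i => f (τ i)) then Q ^ (∑ v, f v) else 0)
      = if Compat p (fun i => f (p i)) ∧ Compat s (fun i => f (s i))
          then Q ^ (∑ v, f v) else 0 := by
    intro f
    obtain ⟨τ₀, h0, hu⟩ := exists_unique_sort f
    rw [Finset.sum_filter, Finset.sum_eq_single τ₀]
    · rw [if_pos h0, ← subseq_iff f τ₀ h0 p hp, ← subseq_iff f τ₀ h0 s hs]
      simp only [IsShuffle]
      congr
    · intro τ _ hne
      rw [if_neg (fun h => hne (hu τ h))]
      simp
    · simp
  rw [tsum_congr h2]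
  let e := Equiv.ofBijective _ hps
  let E : (Fin m → ℕ) × (Fin n → ℕ) ≃ (Fin (m + n) → ℕ) :=
    (Equiv.sumArrowEquivProdArrow _ _ _).symm.trans (e.arrowCongr (Equiv.refl ℕ))
  rw [← E.tsum_eq]
  have hEe : ∀ (x : (Fin m → ℕ) × (Fin n → ℕ)) u, E x (e u) = Sum.elim x.1 x.2 u := by
    intro x u
    simp [E, Equiv.arrowCongr, Equiv.sumArrowEquivProdArrow]
  have hEp : ∀ x i, E x (p i) = x.1 i := fun x i => hEe x (Sum.inl i)
  have hEs : ∀ x i, E x (s i) = x.2 i := fun x i => hEe x (Sum.inr i)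
  have hEsum : ∀ x, ∑ v, E x v = ∑ i, x.1 i + ∑ i, x.2 i := by
    intro x
    rw [← Equiv.sum_comp e]
    simp [hEe]
  simp only [hEp, hEs, hEsum]
  rw [ENNReal.summable.tsum_prod' (fun _ => ENNReal.summable)]
  unfold genf
  rw [← ENNReal.tsum_mul_right]
  refine tsum_congr fun a => ?_
  rw [← ENNReal.tsum_mul_left]
  refine tsum_congr fun b => ?_
  by_cases ha : Compat p a <;> by_cases hb : Compat s b <;> simp [ha, hb, pow_add]

theorem geo_toReal (q : ℝ) (hq0 : 0 < q) (hq1 : q < 1) (N : ℕ) :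
    (geo (ENNReal.ofReal q) N).toReal = ((1 - q) ^ N * qfact q N)⁻¹ := by
  unfold geo qfact
  rw [ENNReal.toReal_prod, ← Finset.card_range N, ← Finset.prod_const, Finset.card_range,
    ← Finset.prod_mul_distrib, ← Finset.prod_inv_distrib]
  refine Finset.prod_congr rfl fun i _ => ?_
  rw [ENNReal.toReal_inv, ← ENNReal.ofReal_pow hq0.le, ← ENNReal.ofReal_one,
    ← ENNReal.ofReal_sub _ (by positivity), ENNReal.toReal_ofReal]
  · rw [qint, mul_comm, geom_sum_mul_neg]
  · have := pow_le_one₀ (n := i + 1) hq0.le hq1.le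
    linarith

theorem qfact_pos (q : ℝ) (hq0 : 0 < q) (N : ℕ) : 0 < qfact q N := by
  unfold qfact qint
  refine Finset.prod_pos fun i _ => Finset.sum_pos (fun j _ => by positivity) (by simp)

open Finset Classical in
/-- **Stanley's Shuffling Theorem.** Let `p` (of length `m`) and `s` (of length `n`)
be words on disjoint value sets whose union is `[m+n]` (encoded by `Sum.elim p s`
being a bijection). Then
`∑_{τ ∈ p ⧢ s} q^{maj τ} = q^{maj p + maj s} · [m+n]_q! / ([m]_q! [n]_q!)`. -/
theorem stanley_shuffling (q : ℝ) (hq0 : 0 < q) (hq1 : q < 1) (m n : ℕ)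
    (p : Fin m → Fin (m + n)) (s : Fin n → Fin (m + n))
    (hps : Function.Bijective (Sum.elim p s)) :
    ∑ τ ∈ univ.filter (fun τ : Equiv.Perm (Fin (m + n)) => IsShuffle p s τ),
        q ^ wmaj (fun i => τ i)
      = q ^ (wmaj p + wmaj s) * qfact q (m + n) / (qfact q m * qfact q n) := by
  have h := congrArg ENNReal.toReal (shuffle_enn (ENNReal.ofReal q) m n p s hps)
  rw [ENNReal.toReal_mul, ENNReal.toReal_mul, ENNReal.toReal_mul, geo_toReal q hq0 hq1,
    geo_toReal q hq0 hq1, geo_toReal q hq0 hq1,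
    ENNReal.toReal_sum (fun _ _ => ENNReal.pow_ne_top ENNReal.ofReal_ne_top)] at h
  simp only [ENNReal.toReal_pow, ENNReal.toReal_ofReal hq0.le] at h
  have a := (qfact_pos q hq0 m).ne'
  have b := (qfact_pos q hq0 n).ne'
  have c := (qfact_pos q hq0 (m + n)).ne'
  have d : 1 - q ≠ 0 := by linarith
  rw [← div_eq_mul_inv, div_eq_iff (mul_ne_zero (pow_ne_zero _ d) c)] at h
  rw [h, pow_add (1 - q)]
  field_simp
end

section
/- Let 0 < q < 1 and π ∼ Maj(n,q). Then the expected number of 2-cycles of π equals ∑_{ℓ=1}^{⌊n/2⌋} q^ℓ (1-q)^{2ℓ-2} / ([ℓ]_q [2ℓ]_q). -/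
/-- The major index of a permutation. -/
def maj {n : ℕ} (π : Equiv.Perm (Fin n)) : ℕ := wmaj (fun i => π i)

/-- The number of 2-cycles of a permutation: unordered pairs `{i,j}`, `i ≠ j`, with
`π i = j` and `π j = i`. -/
def twoCycleCount {n : ℕ} (π : Equiv.Perm (Fin n)) : ℕ :=
  (Finset.univ.filter (fun p : Fin n × Fin n =>
    p.1 < p.2 ∧ π p.1 = p.2 ∧ π p.2 = p.1)).card

open scoped ENNReal

/-- Rank function. -/
def rk {n : ℕ} (w : Fin n → ℕ) (a j : ℕ) : ℕ :=
  ∑ k : Fin n, if a < w k ∨ (w k = a ∧ k.val < j) then 1 else 0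

theorem rk_insert_le {n : ℕ} (p : Fin (n+1)) (x : ℕ) (w : Fin n → ℕ) (a j : ℕ) (h : j ≤ p.val) :
    rk (Fin.insertNth (α := fun _ => ℕ) p x w) a j = (if a < x then 1 else 0) + rk w a j := by
  unfold rk
  rw [Fin.sum_univ_succAbove _ p]
  simp only [Fin.insertNth_apply_same, Fin.insertNth_apply_succAbove]
  congr 1
  · have : ¬ p.val < j := by omega
    simp [this]
  · apply Finset.sum_congr rfl
    intro k _
    have : (p.succAbove k).val < j ↔ k.val < j := by
      unfold Fin.succAbove
      split_ifs with h1
      · simp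
      · simp [Fin.lt_def] at h1 ⊢
        omega
    simp [this]

theorem rk_insert_gt {n : ℕ} (p : Fin (n+1)) (x : ℕ) (w : Fin n → ℕ) (a j : ℕ) (h : p.val ≤ j) :
    rk (Fin.insertNth (α := fun _ => ℕ) p x w) a (j+1) = (if a ≤ x then 1 else 0) + rk w a j := by
  unfold rk
  rw [Fin.sum_univ_succAbove _ p]
  simp only [Fin.insertNth_apply_same, Fin.insertNth_apply_succAbove]
  congr 1
  · have h1 : p.val < j + 1 := by omega
    have h2 : (a < x ∨ x = a ∧ p.val < j + 1) ↔ a ≤ x := by omega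
    simp only [h2]
  · apply Finset.sum_congr rfl
    intro k _
    have : (p.succAbove k).val < j + 1 ↔ k.val < j := by
      unfold Fin.succAbove
      split_ifs with h1
      · simp [Fin.lt_def] at h1 ⊢
        omega
      · simp
    simp [this]

theorem rk_mono {n : ℕ} (w : Fin n → ℕ) (a : ℕ) : Monotone (rk w a) := by
  intro i j hij
  apply Finset.sum_le_sum
  intro k _
  split_ifs <;> omega

theorem rk_le {n : ℕ} (w : Fin n → ℕ) (a j : ℕ) : rk w a j ≤ n := by
  calc rk w a j ≤ ∑ k : Fin n, 1 := by
        apply Finset.sum_le_sum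
        intro k _
        split_ifs <;> omega
    _ = n := by simp

theorem rk_lt_le {n : ℕ} (w : Fin n → ℕ) (a b i j : ℕ) (hab : b < a) : rk w a j ≤ rk w b i := by
  apply Finset.sum_le_sum
  intro k _
  split_ifs <;> omega

theorem rk_succ {n : ℕ} (w : Fin n → ℕ) (a : ℕ) (j : Fin n) :
    rk w a (j.val+1) = rk w a j.val + if w j = a then 1 else 0 := by
  unfold rk
  have : (if w j = a then 1 else 0) = ∑ k : Fin n, if k = j then (if w j = a then 1 else 0) else 0 := by
    simp
  rw [this, ← Finset.sum_add_distrib]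
  apply Finset.sum_congr rfl
  intro k _
  by_cases hk : k = j
  · subst hk
    simp only [if_true]
    split_ifs <;> omega
  · have : k.val ≠ j.val := fun h => hk (Fin.ext h)
    simp only [hk, if_false]
    split_ifs <;> omega

theorem rk_succ' {n : ℕ} (w : Fin n → ℕ) (a j : ℕ) (hj : n ≤ j) :
    rk w a (j+1) = rk w a j := by
  unfold rk
  apply Finset.sum_congr rfl
  intro k _
  have := k.isLt
  have h1 : k.val < j + 1 := by omega
  have h2 : k.val < j := by omega
  simp [h1, h2]

theorem rk_succ_le {n : ℕ} (w : Fin n → ℕ) (a j : ℕ) : rk w a (j+1) ≤ rk w a j + 1 := by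
  by_cases hj : j < n
  · have := rk_succ w a ⟨j, hj⟩
    simp only at this
    rw [this]
    split_ifs <;> omega
  · rw [rk_succ' w a j (by omega)]
    omega

/-- Fixed points of a monotone map with increments at most one. -/
theorem fix_count (h : ℕ → ℕ) (hm : Monotone h) (hs : ∀ i, h (i+1) ≤ h i + 1) (m : ℕ) :
    (∑ i ∈ Finset.range (m+1), if h i = i then 1 else 0) =
    (∑ i ∈ Finset.range m, if h i = i ∧ h (i+1) = i+1 then 1 else 0) +
      if h m ≤ m then 1 else 0 := by
  induction m with
  | zero =>
    rw [Finset.sum_range_succ]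
    simp only [Finset.sum_range_zero, zero_add]
    split_ifs <;> omega
  | succ m ih =>
    rw [Finset.sum_range_succ, ih, Finset.sum_range_succ]
    have h1 := hs m
    have h2 := hm (Nat.le_succ m)
    simp only [Nat.succ_eq_add_one] at h2
    split_ifs <;> omega

/-- number of 2-cycles with letters `b`, `a`. -/
def cab {n : ℕ} (a b : ℕ) (w : Fin n → ℕ) : ℕ :=
  ∑ i : Fin n, ∑ j : Fin n,
    if w i = b ∧ w j = a ∧ rk w a j.val = i.val ∧ rk w b i.val = j.val then 1 else 0

/-- number of fixed pairs. -/
def fab {n : ℕ} (a b : ℕ) (w : Fin n → ℕ) : ℕ :=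
  ∑ i : Fin (n+1), ∑ j : Fin (n+1),
    if rk w a j.val = i.val ∧ rk w b i.val = j.val then 1 else 0

theorem fab_eq {n : ℕ} (a b : ℕ) (w : Fin n → ℕ) : fab a b w = cab a b w + 1 := by
  have key := fix_count (fun i => rk w a (rk w b i)) ((rk_mono w a).comp (rk_mono w b))
    (by
      intro i
      have h1 := rk_succ_le w b i
      have h2 := rk_mono w b (Nat.le_succ i)
      simp only [Nat.succ_eq_add_one] at h2
      have h3 : rk w b (i+1) = rk w b i ∨ rk w b (i+1) = rk w b i + 1 := by omega
      rcases h3 with h3 | h3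
      · simp [h3]
      · simp only [h3]
        exact rk_succ_le _ _ _) n
  have hn : rk w a (rk w b n) ≤ n := rk_le _ _ _
  simp only [hn, if_true] at key
  have e1 : fab a b w = ∑ i ∈ Finset.range (n+1), if rk w a (rk w b i) = i then 1 else 0 := by
    unfold fab
    rw [Finset.sum_range]
    apply Finset.sum_congr rfl
    intro i _
    rw [Finset.sum_eq_single (⟨rk w b i.val, by have := rk_le w b i.val; omega⟩ : Fin (n+1))]
    · simp
    · intro j _ hj
      have : rk w b i.val ≠ j.val := fun h => hj (Fin.ext h.symm)
      simp [this]
    · simp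
  have e2 : cab a b w = ∑ i ∈ Finset.range n,
      if rk w a (rk w b i) = i ∧ rk w a (rk w b (i+1)) = i+1 then 1 else 0 := by
    unfold cab
    rw [Finset.sum_range]
    apply Finset.sum_congr rfl
    intro i _
    by_cases hlt : rk w b i.val < n
    · rw [Finset.sum_eq_single (⟨rk w b i.val, hlt⟩ : Fin n)]
      · have h1 := rk_succ w b i
        have h2 := rk_succ w a ⟨rk w b i.val, hlt⟩
        simp only at h2
        simp only [and_true]
        congr 1
        rw [h1]
        apply propext
        constructor
        · rintro ⟨h3, h4, h5⟩
          refine ⟨h5, ?_⟩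
          simp only [h3, if_true, h2, h4, h5]
        · rintro ⟨h3, h4⟩
          by_cases h5 : w i = b
          · simp only [h5, if_true] at h4
            rw [h4] at h2
            by_cases h6 : w ⟨rk w b i.val, hlt⟩ = a
            · exact ⟨h5, h6, h3⟩
            · simp only [h6, if_false] at h2
              omega
          · simp only [h5, if_false] at h4
            rw [Nat.add_zero] at h4
            omega
      · intro j _ hj
        have : rk w b i.val ≠ j.val := fun h => hj (Fin.ext h.symm)
        simp [this]
      · simp
    · rw [Finset.sum_eq_zero]
      · have h0 := rk_le w b i.val
        have h1 := rk_le w b (i.val+1)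
        have h2 := rk_mono w b (Nat.le_succ i.val)
        simp only [Nat.succ_eq_add_one] at h2
        have h3 : rk w b (i.val+1) = rk w b i.val := by omega
        rw [h3]
        split_ifs <;> omega
      · intro j _
        have : rk w b i.val ≠ j.val := by have := j.isLt; omega
        simp [this]
  rw [e1, e2, key]

theorem tsum_insert {n : ℕ} (p : Fin (n+1)) (F : (Fin (n+1) → ℕ) → ℝ≥0∞) :
    ∑' w, F w = ∑' x : ℕ, ∑' w : Fin n → ℕ, F (Fin.insertNth (α := fun _ => ℕ) p x w) := by
  rw [← (Fin.insertNthEquiv (fun _ => ℕ) p).tsum_eq F, ENNReal.tsum_prod']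
  rfl

theorem tsum_prod_pow {n : ℕ} (r : Fin n → ℝ≥0∞) :
    ∑' w : Fin n → ℕ, ∏ k, r k ^ w k = ∏ k, (1 - r k)⁻¹ := by
  induction n with
  | zero => simp
  | succ n ih =>
    rw [tsum_insert 0, Fin.prod_univ_succ, ← ih, ← ENNReal.tsum_geometric, ← ENNReal.tsum_mul_right]
    apply tsum_congr
    intro x
    rw [← ENNReal.tsum_mul_left]
    apply tsum_congr
    intro w
    rw [Fin.prod_univ_succ]
    simp

/-- sum of letters -/
def wt {n : ℕ} (w : Fin n → ℕ) : ℕ := ∑ k, w k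

theorem wt_insert {n : ℕ} (p : Fin (n+1)) (x : ℕ) (w : Fin n → ℕ) :
    wt (Fin.insertNth (α := fun _ => ℕ) p x w) = x + wt w := by
  unfold wt
  rw [Fin.sum_univ_succAbove _ p]
  simp

theorem tsum_wt (x : ℝ≥0∞) (n : ℕ) : ∑' w : Fin n → ℕ, x ^ wt w = ((1 - x)⁻¹) ^ n := by
  have := tsum_prod_pow (fun _ : Fin n => x)
  simp only [Finset.prod_pow_eq_pow_sum, Finset.prod_const, Finset.card_univ, Fintype.card_fin] at this
  exact this

theorem cab_rec (x : ℝ≥0∞) (n a b : ℕ) (hab : b < a) :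
    ∑' w : Fin (n+2) → ℕ, x ^ wt w * (cab a b w : ℝ≥0∞) =
      x ^ (a+b) * ∑' w : Fin n → ℕ, x ^ wt w * (fab a b w : ℝ≥0∞) := by
  have h1 : ∀ w : Fin (n+2) → ℕ, cab a b w = ∑ i : Fin (n+1), ∑ j : Fin (n+1),
      if w i.castSucc = b ∧ w j.succ = a ∧ rk w a (j.val+1) = i.val ∧ rk w b i.val = j.val + 1
        then 1 else 0 := by
    intro w
    have hz : ∀ i j : Fin (n+2), ¬ i < j →
        ¬ (w i = b ∧ w j = a ∧ rk w a j.val = i.val ∧ rk w b i.val = j.val) := by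
      rintro i j hij ⟨h1, h2, h3, h4⟩
      have := rk_lt_le w a b i.val j.val hab
      apply hij
      rw [Fin.lt_def]
      rcases Nat.lt_or_ge i.val j.val with h | h
      · exact h
      · have : i = j := Fin.ext (by omega)
        subst this
        omega
    unfold cab
    rw [Fin.sum_univ_castSucc]
    have hlast : ∑ j : Fin (n+2), (if w (Fin.last (n + 1)) = b ∧ w j = a ∧
        rk w a j.val = (Fin.last (n + 1)).val ∧ rk w b (Fin.last (n + 1)).val = j.val
        then 1 else 0) = 0 := by
      apply Finset.sum_eq_zero
      intro j _
      rw [if_neg (hz _ _ (by simpa using Fin.le_last j))]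
    rw [hlast, add_zero]
    · apply Finset.sum_congr rfl
      intro i _
      rw [Fin.sum_univ_succ, if_neg (hz _ _ (by simp)), zero_add]
      rfl
  simp only [h1, fab]
  push_cast
  simp only [Finset.mul_sum]
  rw [Summable.tsum_finsetSum (fun _ _ => ENNReal.summable),
    Summable.tsum_finsetSum (fun _ _ => ENNReal.summable), Finset.mul_sum]
  apply Finset.sum_congr rfl
  intro i _
  rw [Summable.tsum_finsetSum (fun _ _ => ENNReal.summable),
    Summable.tsum_finsetSum (fun _ _ => ENNReal.summable), Finset.mul_sum]
  apply Finset.sum_congr rfl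
  intro j _
  by_cases hij : i ≤ j
  · have hs : i.castSucc.succAbove j = j.succ := by
      rw [Fin.succAbove_of_le_castSucc]
      simpa using hij
    rw [tsum_insert i.castSucc, tsum_eq_single b, tsum_insert j, tsum_eq_single a]
    · rw [← ENNReal.tsum_mul_left]
      apply tsum_congr
      intro w
      rw [wt_insert, wt_insert, ← hs, Fin.insertNth_apply_same, Fin.insertNth_apply_succAbove,
        Fin.insertNth_apply_same, rk_insert_gt _ _ _ _ _ (by simpa using hij),
        rk_insert_le _ _ _ _ _ (le_refl _), rk_insert_le _ _ _ _ _ (by simp),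
        rk_insert_le _ _ _ _ _ (by simpa using hij)]
      have e : (b ≤ a) := hab.le
      have e2 : ¬ (a ≤ b) := by omega
      simp only [e2, if_false, lt_irrefl, hab, if_true, true_and, zero_add]
      simp only [add_comm 1, Nat.add_right_cancel_iff]
      rw [← mul_assoc, ← pow_add]
      congr 2
      omega
    · intro y hy
      rw [ENNReal.tsum_eq_zero]
      intro w
      rw [← hs, Fin.insertNth_apply_succAbove, Fin.insertNth_apply_same]
      simp [hy]
    · intro y hy
      rw [ENNReal.tsum_eq_zero]
      intro w
      rw [Fin.insertNth_apply_same]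
      simp [hy]
  · have z1 : ∀ w : Fin (n+2) → ℕ, ¬ (w i.castSucc = b ∧ w j.succ = a ∧
        rk w a (j.val+1) = i.val ∧ rk w b i.val = j.val + 1) := by
      rintro w ⟨h1, h2, h3, h4⟩
      have := rk_lt_le w a b i.val (j.val+1) hab
      rw [Fin.le_def] at hij
      have : i.castSucc = j.succ := Fin.ext (by simp; omega)
      rw [this] at h1
      omega
    have z2 : ∀ w : Fin n → ℕ, ¬ (rk w a j.val = i.val ∧ rk w b i.val = j.val) := by
      rintro w ⟨h3, h4⟩
      have := rk_lt_le w a b i.val j.val hab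
      rw [Fin.le_def] at hij
      omega
    simp [z1, z2]

theorem cab_sum (x : ℝ≥0∞) (a b : ℕ) (hab : b < a) (n : ℕ) :
    ∑' w : Fin n → ℕ, x ^ wt w * (cab a b w : ℝ≥0∞) =
      ∑ l ∈ Finset.range (n/2), (x ^ (a+b))^(l+1) * ((1-x)⁻¹)^(n - 2*(l+1)) := by
  induction n using Nat.strong_induction_on with
  | _ n ih =>
    match n, ih with
    | 0, _ => simp [cab]
    | 1, _ =>
      simp only [Nat.reduceDiv, Finset.range_zero, Finset.sum_empty]
      rw [ENNReal.tsum_eq_zero]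
      intro w
      have : cab a b w = 0 := by
        unfold cab
        simp
        omega
      simp [this]
    | n+2, ih =>
      rw [cab_rec x n a b hab]
      simp only [fab_eq]
      push_cast
      simp only [mul_add, mul_one]
      rw [ENNReal.tsum_add, ih n (by omega), tsum_wt]
      have : (n+2)/2 = n/2+1 := by omega
      rw [this, Finset.sum_range_succ', mul_add, Finset.mul_sum]
      congr 1
      · apply Finset.sum_congr rfl
        intro l _
        rw [← mul_assoc, ← pow_succ']
        congr 2
        omega
      · simp

/-- descent indicator -/
def dsc {n : ℕ} (π : Equiv.Perm (Fin n)) (k : ℕ) : ℕ :=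
  if h : k + 1 < n then (if π ⟨k+1, h⟩ < π ⟨k, Nat.lt_of_succ_lt h⟩ then 1 else 0) else 0

/-- the partition attached to `π` and `g` -/
def ptn {n : ℕ} (π : Equiv.Perm (Fin n)) (g : Fin n → ℕ) (i : ℕ) : ℕ :=
  ∑ k : Fin n, if i ≤ k.val then g k + dsc π k.val else 0

theorem ptn_succ {n : ℕ} (π : Equiv.Perm (Fin n)) (g : Fin n → ℕ) (i : Fin n) :
    ptn π g i.val = ptn π g (i.val+1) + (g i + dsc π i.val) := by
  unfold ptn
  have : g i + dsc π i.val = ∑ k : Fin n, if k = i then g i + dsc π i.val else 0 := by simp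
  rw [this, ← Finset.sum_add_distrib]
  apply Finset.sum_congr rfl
  intro k _
  by_cases hk : k = i
  · subst hk
    simp
  · have : k.val ≠ i.val := fun h => hk (Fin.ext h)
    simp only [hk, if_false]
    split_ifs <;> omega

theorem ptn_n {n : ℕ} (π : Equiv.Perm (Fin n)) (g : Fin n → ℕ) : ptn π g n = 0 := by
  unfold ptn
  apply Finset.sum_eq_zero
  intro k _
  have := k.isLt
  rw [if_neg (by omega)]

theorem ptn_anti {n : ℕ} (π : Equiv.Perm (Fin n)) (g : Fin n → ℕ) : Antitone (ptn π g) := by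
  intro i j hij
  apply Finset.sum_le_sum
  intro k _
  split_ifs <;> omega

theorem ptn_chain {n : ℕ} (π : Equiv.Perm (Fin n)) (g : Fin n → ℕ) (i : Fin n) (j : ℕ)
    (hij : i.val + 1 ≤ j) : ∀ hj : j < n, ptn π g i.val = ptn π g j → π i < π ⟨j, hj⟩ := by
  have step : ∀ (k : ℕ) (hk : k + 1 < n), ptn π g k = ptn π g (k+1) →
      π ⟨k, by omega⟩ < π ⟨k+1, hk⟩ := by
    intro k hk h
    have h1 := ptn_succ π g ⟨k, by omega⟩
    simp only at h1
    have h2 : dsc π k = 0 := by omega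
    unfold dsc at h2
    rw [dif_pos hk] at h2
    have h3 : ¬ (π ⟨k+1, hk⟩ < π ⟨k, by omega⟩) := by
      intro h4
      rw [if_pos h4] at h2
      omega
    refine lt_of_le_of_ne (not_lt.mp h3) ?_
    intro h4
    have := congrArg Fin.val (π.injective h4)
    simp at this
  induction j, hij using Nat.le_induction with
  | base =>
    intro hj h
    exact step i.val hj h
  | succ j hj ih =>
    intro hj' h
    have h1 := ptn_anti π g (Nat.le_succ j)
    have h2 := ptn_anti π g (show i.val ≤ j by omega)
    simp only [Nat.succ_eq_add_one] at h1
    exact (ih (by omega) (by omega) (by omega)).trans (step j hj' (by omega))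

/-- The word attached to `π` and `g`. -/
def wrd {n : ℕ} (x : Equiv.Perm (Fin n) × (Fin n → ℕ)) : Fin n → ℕ :=
  fun m => ptn x.1 x.2 (x.1.symm m).val

theorem wrd_sort {n : ℕ} (π : Equiv.Perm (Fin n)) (g : Fin n → ℕ) :
    π = Tuple.sort (fun m => OrderDual.toDual (wrd (π, g) m)) := by
  rw [Tuple.eq_sort_iff]
  constructor
  · intro i j hij
    simp only [Function.comp, wrd, Equiv.symm_apply_apply]
    exact ptn_anti π g hij
  · intro i j hij h
    simp only [wrd, Equiv.symm_apply_apply] at h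
    exact ptn_chain π g i j.val hij j.isLt (OrderDual.toDual.injective h)

theorem wrd_bij {n : ℕ} : Function.Bijective (wrd (n := n)) := by
  constructor
  · rintro ⟨π, g⟩ ⟨π', g'⟩ h
    have h1 : π = π' := by
      rw [wrd_sort π g, wrd_sort π' g', h]
    subst h1
    have h2 : ∀ i : ℕ, i ≤ n → ptn π g i = ptn π g' i := by
      intro i hi
      rcases hi.lt_or_eq with hi | hi
      · have := congrFun h (π ⟨i, hi⟩)
        simpa [wrd] using this
      · subst hi
        rw [ptn_n, ptn_n]
    have h3 : g = g' := by
      funext i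
      have e1 := ptn_succ π g i
      have e2 := ptn_succ π g' i
      rw [h2 _ i.isLt.le, h2 (i.val+1) i.isLt] at e1
      omega
    rw [h3]
  · intro w
    obtain ⟨π, hπ⟩ : ∃ π, π = Tuple.sort (fun m => OrderDual.toDual (w m)) := ⟨_, rfl⟩
    rw [Tuple.eq_sort_iff] at hπ
    obtain ⟨hm, ht⟩ := hπ
    let e : ℕ → ℕ := fun i => if h : i < n then w (π ⟨i, h⟩) else 0
    have he : ∀ i, i < n → e (i+1) + dsc π i ≤ e i := by
      intro i hi
      by_cases h1 : i + 1 < n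
      · simp only [e, dif_pos hi, dif_pos h1, dsc]
        have hle : w (π ⟨i+1, h1⟩) ≤ w (π ⟨i, hi⟩) := by
          have := hm (show (⟨i, hi⟩ : Fin n) ≤ ⟨i+1, h1⟩ by simp [Fin.le_def])
          exact this
        split_ifs with h2
        · have hne : w (π ⟨i+1, h1⟩) ≠ w (π ⟨i, hi⟩) := by
            intro h3
            have := ht ⟨i, hi⟩ ⟨i+1, h1⟩ (by simp [Fin.lt_def]) (by simp [h3])
            exact absurd h2 (not_lt.mpr this.le)
          omega
        · omega
      · simp [e, dif_neg h1, dsc]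
    let g : Fin n → ℕ := fun i => e i.val - e (i.val+1) - dsc π i.val
    have hp : ∀ d i, i + d = n → ptn π g i = e i := by
      intro d
      induction d with
      | zero =>
        intro i hi
        have : i = n := by omega
        rw [this, ptn_n]
        simp [e]
      | succ d ih =>
        intro i hi
        have h1 := ptn_succ π g ⟨i, by omega⟩
        simp only at h1
        rw [h1, ih (i+1) (by omega)]
        have := he i (by omega)
        simp only [g]
        omega
    refine ⟨(π, g), ?_⟩
    funext m
    simp only [wrd]
    rw [hp (n - (π.symm m).val) _ (by have := (π.symm m).isLt; omega)]
    simp [e]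

theorem maj_eq {n : ℕ} (π : Equiv.Perm (Fin n)) : maj π = ∑ k : Fin n, (k.val+1) * dsc π k.val := by
  unfold maj wmaj
  rw [Fin.sum_univ_eq_sum_range (fun k => (k+1) * dsc π k) n]
  have h : ∀ i, (if h : i + 1 < n then
      (if π ⟨i + 1, h⟩ < π ⟨i, Nat.lt_of_succ_lt h⟩ then i + 1 else 0) else 0)
      = (i+1) * dsc π i := by
    intro i
    unfold dsc
    split_ifs <;> simp
  simp only [h]
  cases n with
  | zero => simp
  | succ m =>
    rw [Finset.sum_range_succ, Nat.add_sub_cancel]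
    simp [dsc]

theorem wt_wrd {n : ℕ} (π : Equiv.Perm (Fin n)) (g : Fin n → ℕ) :
    wt (wrd (π, g)) = maj π + ∑ k : Fin n, (k.val+1) * g k := by
  unfold wt wrd
  rw [Equiv.sum_comp π.symm (fun i => ptn π g i.val), maj_eq, ← Finset.sum_add_distrib]
  unfold ptn
  rw [Finset.sum_comm]
  apply Finset.sum_congr rfl
  intro k _
  rw [← Finset.sum_filter, Finset.sum_const]
  have : (Finset.univ.filter (fun i : Fin n => i.val ≤ k.val)).card = k.val + 1 := by
    have : Finset.univ.filter (fun i : Fin n => i.val ≤ k.val) = Finset.Iic k := by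
      ext i
      simp
    rw [this, Fin.card_Iic]
  rw [this, smul_eq_mul]
  ring

theorem rank_eq {n : ℕ} (π : Equiv.Perm (Fin n)) (w : Fin n → ℕ)
    (h : π = Tuple.sort (fun m => OrderDual.toDual (w m))) (j : Fin n) :
    rk w (w j) j.val = (π.symm j).val := by
  rw [Tuple.eq_sort_iff] at h
  obtain ⟨hm, ht⟩ := h
  have hm' : ∀ a b, a ≤ b → w (π b) ≤ w (π a) := fun a b hab => hm hab
  have ht' : ∀ a b, a < b → w (π a) = w (π b) → π a < π b := fun a b hab e =>
    ht a b hab (by simp [e])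
  have key : ∀ a b, (w (π b) < w (π a) ∨ (w (π a) = w (π b) ∧ (π a).val < (π b).val)) ↔ a < b := by
    intro a b
    constructor
    · intro h1
      by_contra h2
      have h3 := hm' b a (not_lt.mp h2)
      rcases h1 with h1 | ⟨h1, h4⟩
      · omega
      · rcases (not_lt.mp h2).lt_or_eq with h5 | h5
        · have := ht' b a h5 h1.symm
          rw [Fin.lt_def] at this
          omega
        · subst h5
          omega
    · intro h1
      have h2 := hm' a b h1.le
      rcases h2.lt_or_eq with h3 | h3
      · exact Or.inl h3
      · exact Or.inr ⟨h3.symm, ht' a b h1 h3.symm⟩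
  unfold rk
  rw [← Equiv.sum_comp π]
  have : ∀ k, (w j < w (π k) ∨ (w (π k) = w j ∧ (π k).val < j.val)) ↔ k < π.symm j := by
    intro k
    have := key k (π.symm j)
    simpa using this
  simp only [this]
  rw [← Finset.sum_filter, Finset.sum_const]
  have : Finset.univ.filter (fun k : Fin n => k < π.symm j) = Finset.Iio (π.symm j) := by
    ext i
    simp
  rw [this, Fin.card_Iio]
  simp

theorem tcc_eq {n : ℕ} (π : Equiv.Perm (Fin n)) (w : Fin n → ℕ)
    (h : π = Tuple.sort (fun m => OrderDual.toDual (w m))) :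
    twoCycleCount π = ∑ i : Fin n, ∑ j : Fin n,
      if w i < w j ∧ rk w (w j) j.val = i.val ∧ rk w (w i) i.val = j.val then 1 else 0 := by
  unfold twoCycleCount
  rw [Finset.card_filter, Fintype.sum_prod_type]
  apply Finset.sum_congr rfl
  intro i _
  apply Finset.sum_congr rfl
  intro j _
  have hi := rank_eq π w h i
  have hj := rank_eq π w h j
  rw [Tuple.eq_sort_iff] at h
  obtain ⟨hm, ht⟩ := h
  have hm' : ∀ a b, a ≤ b → w (π b) ≤ w (π a) := fun a b hab => hm hab
  have ht' : ∀ a b, a < b → w (π a) = w (π b) → π a < π b := fun a b hab e =>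
    ht a b hab (by simp [e])
  congr 1
  apply propext
  simp only
  rw [hi, hj]
  constructor
  · rintro ⟨h1, h2, h3⟩
    have e1 : π.symm j = i := by rw [← h2]; simp
    have e2 : π.symm i = j := by rw [← h3]; simp
    refine ⟨?_, by rw [e1], by rw [e2]⟩
    have h4 := hm' i j h1.le
    rw [h2, h3] at h4
    refine lt_of_le_of_ne h4 ?_
    intro h5
    have h6 := ht' i j h1 (by rw [h2, h3, h5])
    rw [h2, h3] at h6
    exact absurd h1 (not_lt.mpr h6.le)
  · rintro ⟨h1, h2, h3⟩
    have e1 : π.symm j = i := Fin.ext h2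
    have e2 : π.symm i = j := Fin.ext h3
    have e3 : π i = j := by rw [← e1]; simp
    have e4 : π j = i := by rw [← e2]; simp
    refine ⟨?_, e3, e4⟩
    by_contra h4
    have h5 := hm' j i (not_lt.mp h4)
    rw [e3, e4] at h5
    omega

theorem tcc_cab {n : ℕ} (π : Equiv.Perm (Fin n)) (w : Fin n → ℕ)
    (h : π = Tuple.sort (fun m => OrderDual.toDual (w m))) :
    (twoCycleCount π : ℝ≥0∞) = ∑' b : ℕ, ∑' d : ℕ, (cab (b+1+d) b w : ℝ≥0∞) := by
  rw [tcc_eq π w h]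
  unfold cab
  push_cast
  simp_rw [Summable.tsum_finsetSum (fun _ _ => ENNReal.summable)]
  apply Finset.sum_congr rfl
  intro i _
  apply Finset.sum_congr rfl
  intro j _
  rw [tsum_eq_single (w i), tsum_eq_single (w j - (w i + 1))]
  · congr 1
    apply propext
    constructor
    · rintro ⟨h1, h2, h3⟩
      have : w i + 1 + (w j - (w i + 1)) = w j := by omega
      rw [this]
      exact ⟨rfl, rfl, h2, h3⟩
    · rintro ⟨-, h1, h2, h3⟩
      rw [← h1] at h2
      exact ⟨by omega, h2, h3⟩
  · intro d hd
    rw [if_neg]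
    rintro ⟨-, h1, -⟩
    omega
  · intro b hb
    rw [ENNReal.tsum_eq_zero]
    intro d
    rw [if_neg]
    rintro ⟨h1, -⟩
    exact hb h1.symm

theorem main_enn (x : ℝ≥0∞) (n : ℕ) :
    (∑ π : Equiv.Perm (Fin n), (twoCycleCount π : ℝ≥0∞) * x ^ maj π) *
      ∏ k : Fin n, (1 - x ^ (k.val+1))⁻¹ =
    ∑ l ∈ Finset.range (n/2), x ^ (l+1) * (1 - x^(l+1))⁻¹ * (1 - x^(2*(l+1)))⁻¹ *
      ((1-x)⁻¹)^(n - 2*(l+1)) := by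
  have h1 : (∑ π : Equiv.Perm (Fin n), (twoCycleCount π : ℝ≥0∞) * x ^ maj π) *
      ∏ k : Fin n, (1 - x ^ (k.val+1))⁻¹ =
      ∑' w : Fin n → ℕ, x ^ wt w * ∑' b : ℕ, ∑' d : ℕ, (cab (b+1+d) b w : ℝ≥0∞) := by
    rw [← (Equiv.ofBijective _ (wrd_bij (n := n))).tsum_eq, ENNReal.tsum_prod', tsum_fintype,
      Finset.sum_mul]
    apply Finset.sum_congr rfl
    intro π _
    rw [← tsum_prod_pow, ← ENNReal.tsum_mul_left]
    apply tsum_congr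
    intro g
    simp only [Equiv.ofBijective_apply]
    rw [← tcc_cab π _ (wrd_sort π g), wt_wrd, pow_add]
    simp only [← pow_mul, Finset.prod_pow_eq_pow_sum]
    ring
  rw [h1]
  simp_rw [← ENNReal.tsum_mul_left]
  rw [ENNReal.tsum_comm]
  have h2 : ∀ b : ℕ, ∑' (w : Fin n → ℕ) (d : ℕ), x ^ wt w * (cab (b+1+d) b w : ℝ≥0∞) =
      ∑' d : ℕ, ∑ l ∈ Finset.range (n/2),
        (x ^ (b+1+d+b))^(l+1) * ((1-x)⁻¹)^(n - 2*(l+1)) := by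
    intro b
    rw [ENNReal.tsum_comm]
    apply tsum_congr
    intro d
    exact cab_sum x _ _ (by omega) n
  simp_rw [h2, Summable.tsum_finsetSum (fun _ _ => ENNReal.summable)]
  apply Finset.sum_congr rfl
  intro l _
  simp_rw [ENNReal.tsum_mul_right]
  congr 1
  have h3 : ∀ b d : ℕ, (x ^ (b+1+d+b))^(l+1) =
      x ^ (l+1) * ((x^(2*(l+1)))^b * (x^(l+1))^d) := by
    intro b d
    simp only [← pow_mul, ← pow_add]
    congr 1
    ring
  simp_rw [h3, ENNReal.tsum_mul_left, ENNReal.tsum_mul_right, ENNReal.tsum_geometric]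
  ring

/-- Under `Maj(n,q)` the expected number of 2-cycles is
`∑_{ℓ=1}^{⌊n/2⌋} q^ℓ (1-q)^{2ℓ-2} / ([ℓ]_q [2ℓ]_q)`. -/
theorem expected_two_cycles (q : ℝ) (hq0 : 0 < q) (hq1 : q < 1) (n : ℕ) :
    ∑ π : Equiv.Perm (Fin n),
        (twoCycleCount π : ℝ) * (q ^ maj π / qfact q n)
      = ∑ ℓ ∈ Finset.Icc 1 (n / 2),
          q ^ ℓ * (1 - q) ^ (2 * ℓ - 2) / (qint q ℓ * qint q (2 * ℓ)) := by
  have hp : ∀ m : ℕ, 0 < m → q ^ m < 1 := fun m hm => pow_lt_one₀ hq0.le hq1 (by omega)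
  have hqi : ∀ m : ℕ, qint q m = (1 - q ^ m) / (1 - q) := by
    intro m
    unfold qint
    rw [geom_sum_eq hq1.ne, ← neg_sub (1 : ℝ) q, ← neg_sub (1 : ℝ) (q ^ m), neg_div_neg_eq]
  have hsub : ∀ m : ℕ, (1 - (ENNReal.ofReal q) ^ m).toReal = 1 - q ^ m := by
    intro m
    rw [← ENNReal.ofReal_pow hq0.le, ← ENNReal.ofReal_one, ← ENNReal.ofReal_sub _ (by positivity),
      ENNReal.toReal_ofReal]
    have := pow_le_one₀ (n := m) hq0.le hq1.le
    linarith
  have hfin : ∀ m : ℕ, 0 < m → (1 - (ENNReal.ofReal q) ^ m)⁻¹ ≠ ⊤ := by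
    intro m hm
    rw [ENNReal.inv_ne_top, ← ENNReal.ofReal_pow hq0.le, ne_eq, tsub_eq_zero_iff_le, not_le]
    rw [← ENNReal.ofReal_one]
    exact (ENNReal.ofReal_lt_ofReal_iff one_pos).mpr (hp m hm)
  have hx : ENNReal.ofReal q ≠ ⊤ := ENNReal.ofReal_ne_top
  have hxr : (ENNReal.ofReal q).toReal = q := ENNReal.toReal_ofReal hq0.le
  have hs1 : (1 - ENNReal.ofReal q).toReal = 1 - q := by simpa using hsub 1
  have hf1 : (1 - ENNReal.ofReal q)⁻¹ ≠ ⊤ := by simpa using hfin 1 one_pos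
  have main := congrArg ENNReal.toReal (main_enn (ENNReal.ofReal q) n)
  rw [ENNReal.toReal_mul, ENNReal.toReal_sum, ENNReal.toReal_prod, ENNReal.toReal_sum] at main
  rotate_left
  · intro l _
    exact ENNReal.mul_ne_top (ENNReal.mul_ne_top (ENNReal.mul_ne_top (ENNReal.pow_ne_top hx)
      (hfin _ (by omega))) (hfin _ (by omega))) (ENNReal.pow_ne_top hf1)
  · intro π _
    exact ENNReal.mul_ne_top (ENNReal.natCast_ne_top _) (ENNReal.pow_ne_top hx)
  simp only [ENNReal.toReal_mul, ENNReal.toReal_pow, ENNReal.toReal_inv, ENNReal.toReal_natCast,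
    hsub, hs1, hxr] at main
  have hq1' : (1 - q) ≠ 0 := by linarith
  have hfact : (qfact q n)⁻¹ = (∏ k : Fin n, (1 - q ^ (k.val+1))⁻¹) * (1 - q) ^ n := by
    unfold qfact
    rw [Fin.prod_univ_eq_prod_range (fun k => (1 - q ^ (k+1))⁻¹) n, ← Finset.prod_inv_distrib]
    have : (1 - q) ^ n = ∏ _k ∈ Finset.range n, (1 - q) := by simp
    rw [this, ← Finset.prod_mul_distrib]
    apply Finset.prod_congr rfl
    intro k _
    rw [hqi, inv_div, div_eq_mul_inv, mul_comm]
  simp only [div_eq_mul_inv (q ^ maj _), ← mul_assoc]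
  rw [← Finset.sum_mul, hfact, ← mul_assoc, main, Finset.sum_mul,
    Finset.range_eq_Ico, Finset.sum_Ico_add' (fun l => q ^ l * (1 - q ^ l)⁻¹ *
      (1 - q ^ (2 * l))⁻¹ * (1 - q)⁻¹ ^ (n - 2 * l) * (1 - q) ^ n) 0 (n/2) 1]
  have hI : Finset.Ico (0 + 1) (n/2 + 1) = Finset.Icc 1 (n/2) := by
    ext l
    simp
  rw [hI]
  apply Finset.sum_congr rfl
  intro l hl
  rw [Finset.mem_Icc] at hl
  have h1 : 1 - q ^ l ≠ 0 := by have := hp l (by omega); linarith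
  have h2 : 1 - q ^ (2 * l) ≠ 0 := by have := hp (2 * l) (by omega); linarith
  obtain ⟨m, rfl⟩ : ∃ m, l = m + 1 := ⟨l - 1, by omega⟩
  obtain ⟨r, hr⟩ : ∃ r, n = 2 * (m + 1) + r := ⟨n - 2 * (m + 1), by omega⟩
  have e1 : n - 2 * (m + 1) = r := by omega
  have e2 : 2 * (m + 1) - 2 = 2 * m := by omega
  have e3 : (1 - q)⁻¹ ^ r * (1 - q) ^ n = (1 - q) ^ (2 * m) * (1 - q) ^ 2 := by
    rw [hr, inv_pow, pow_add _ _ r, mul_comm _ ((1 - q) ^ r), ← mul_assoc,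
      inv_mul_cancel₀ (pow_ne_zero _ hq1'), one_mul, ← pow_add]
    rfl
  rw [e1, e2, hqi, hqi, mul_assoc, e3]
  field_simp
end

section
/- For 0 < q < 1, the limit as n → ∞ of the variance of the number of fixed points of π ∼ Maj(n,q) equals ∑_{ℓ ≥ 1} ℓ(1-q)^{ℓ-1} / [ℓ]_q. -/
open Filter

/-- The number of fixed points of a permutation. -/
def fixedPointCount {n : ℕ} (π : Equiv.Perm (Fin n)) : ℕ :=
  (Finset.univ.filter (fun i : Fin n => π i = i)).card

/-- Expectation of a statistic under `Maj(n,q)`. -/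
noncomputable def majExp (q : ℝ) (n : ℕ) (X : Equiv.Perm (Fin n) → ℝ) : ℝ :=
  ∑ π : Equiv.Perm (Fin n), X π * (q ^ maj π / qfact q n)


/-- Extension of a permutation of `Fin n` to `ℕ` by the identity. -/
def extP {n : ℕ} (π : Equiv.Perm (Fin n)) (i : ℕ) : ℕ := if h : i < n then (π ⟨i, h⟩ : ℕ) else i

def majN (W : ℕ → ℕ) (N : ℕ) : ℕ := ∑ i ∈ Finset.range N, if W (i + 1) < W i then i + 1 else 0

def liftN (v x : ℕ) : ℕ := if x < v then x else x + 1

def insW (W : ℕ → ℕ) (p v i : ℕ) : ℕ :=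
  if i < p then liftN v (W i) else if i = p then v else liftN v (W (i - 1))

lemma liftN_lt (v x y : ℕ) : liftN v x < liftN v y ↔ x < y := by
  unfold liftN; split_ifs <;> omega

lemma maj_eq_s15 {n : ℕ} (π : Equiv.Perm (Fin n)) : maj π = majN (extP π) n := by
  unfold maj wmaj majN
  cases n with
  | zero => simp
  | succ m =>
    rw [Finset.sum_range_succ]
    have h1 : ¬ (extP π (m+1) < extP π m) := by
      unfold extP
      simp
      try omega
    rw [if_neg h1, add_zero]
    simp only [Nat.add_sub_cancel]
    apply Finset.sum_congr rfl
    intro i hi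
    have hi := Finset.mem_range.1 hi
    rw [dif_pos (by omega)]
    unfold extP
    rw [dif_pos (by omega), dif_pos (by omega)]
    simp only [Fin.lt_def]

def dN (W : ℕ → ℕ) (i : ℕ) : ℕ := if W (i + 1) < W i then 1 else 0
def zN (W v : ℕ → ℕ) (i : ℕ) : ℕ := if v i ≤ W i ∧ W i < v (i + 1) then 1 else 0
def mN (W v : ℕ → ℕ) (i : ℕ) : ℕ := if W i < v i then 1 else 0
def fN (W v : ℕ → ℕ) (N p : ℕ) : ℕ := (∑ i ∈ Finset.Ico p N, (dN W i + zN W v i)) + mN W v p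
def GN (W v : ℕ → ℕ) (N p : ℕ) : ℕ :=
  majN (insW W p (v p)) (N + 1) + ∑ i ∈ Finset.Ico p N, zN W v i

lemma ins_tail (W : ℕ → ℕ) (p v N : ℕ) :
    (∑ i ∈ Finset.Ico (p + 1) (N + 1), if insW W p v (i + 1) < insW W p v i then i + 1 else 0)
     = (∑ i ∈ Finset.Ico p N, if W (i + 1) < W i then i + 1 else 0) + ∑ i ∈ Finset.Ico p N, dN W i := by
  rw [← Finset.sum_add_distrib, ← Finset.sum_Ico_add']
  apply Finset.sum_congr rfl
  intro i hi
  have hi := Finset.mem_Ico.1 hi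
  have h1 : insW W p v (i + 1 + 1) = liftN v (W (i + 1)) := by
    unfold insW; rw [if_neg (by omega), if_neg (by omega)]; rfl
  have h2 : insW W p v (i + 1) = liftN v (W i) := by
    unfold insW; rw [if_neg (by omega), if_neg (by omega)]; rfl
  rw [h1, h2]; simp only [liftN_lt, dN]
  split_ifs <;> rfl

lemma ins_mid (W : ℕ → ℕ) (p v : ℕ) :
    insW W p v (p + 1) < insW W p v p ↔ W p < v := by
  have h1 : insW W p v (p + 1) = liftN v (W p) := by
    unfold insW; rw [if_neg (by omega), if_neg (by omega)]; rfl
  have h2 : insW W p v p = v := by simp [insW]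
  rw [h1, h2]; unfold liftN; split_ifs <;> omega

lemma ins_pre (W : ℕ → ℕ) (p v : ℕ) :
    insW W (p + 1) v (p + 1) < insW W (p + 1) v p ↔ v ≤ W p := by
  have h1 : insW W (p + 1) v p = liftN v (W p) := by
    unfold insW; rw [if_pos (by omega)]
  have h2 : insW W (p + 1) v (p + 1) = v := by simp [insW]
  rw [h1, h2]; unfold liftN; split_ifs <;> omega

lemma GN_zero (W v : ℕ → ℕ) (N : ℕ) : GN W v N 0 = majN W N + fN W v N 0 := by
  unfold GN fN majN
  rw [Finset.range_eq_Ico, Finset.range_eq_Ico, Finset.sum_eq_sum_Ico_succ_bot (by omega), ins_tail,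
    Finset.sum_add_distrib]
  have := ins_mid W 0 (v 0)
  rw [zero_add] at this
  simp only [zero_add, this, mN]
  ring

lemma GN_succ (W v : ℕ → ℕ) (N p : ℕ) (hp : p < N) :
    GN W v N (p + 1) + (p + 1) * dN W p = majN W N + fN W v N (p + 1) +
      (p + 1) * ((if v (p + 1) ≤ W p then 1 else 0) + mN W v (p + 1)) := by
  unfold GN fN majN
  rw [Finset.range_eq_Ico, Finset.range_eq_Ico,
    ← Finset.sum_Ico_consecutive _ (Nat.zero_le p) (show p ≤ N + 1 by omega),
    ← Finset.sum_Ico_consecutive _ (Nat.zero_le p) (show p ≤ N by omega),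
    Finset.sum_eq_sum_Ico_succ_bot (show p < N + 1 by omega),
    Finset.sum_eq_sum_Ico_succ_bot (show p + 1 < N + 1 by omega),
    Finset.sum_eq_sum_Ico_succ_bot (show p < N by omega), ins_tail, Finset.sum_add_distrib]
  have h0 : (∑ i ∈ Finset.Ico 0 p, if insW W (p + 1) (v (p + 1)) (i + 1) < insW W (p + 1) (v (p + 1)) i then i + 1 else 0)
     = ∑ i ∈ Finset.Ico 0 p, if W (i + 1) < W i then i + 1 else 0 := by
    apply Finset.sum_congr rfl
    intro i hi
    have hi := Finset.mem_Ico.1 hi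
    unfold insW
    rw [if_pos (show i + 1 < p + 1 by omega), if_pos (show i < p + 1 by omega)]
    simp only [liftN_lt]
  rw [h0]
  simp only [ins_mid, ins_pre, mN, dN]
  split_ifs <;> ring

lemma fN_succ (W v : ℕ → ℕ) (N p : ℕ) (hp : p < N) (hv : v p ≤ v (p + 1)) :
    fN W v N p + (if v (p + 1) ≤ W p then 1 else 0) + mN W v (p + 1) = fN W v N (p + 1) + 1 + dN W p := by
  unfold fN
  rw [Finset.sum_eq_sum_Ico_succ_bot hp]
  have : zN W v p + mN W v p + (if v (p + 1) ≤ W p then 1 else 0) = 1 := by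
    unfold zN mN; split_ifs <;> omega
  omega

lemma qint_succ (q : ℝ) (m : ℕ) : qint q (m + 1) = qint q m + q ^ m := by
  unfold qint; rw [Finset.sum_range_succ]

lemma qint_succ' (q : ℝ) (m : ℕ) : qint q (m + 1) = q * qint q m + 1 := by
  unfold qint; rw [Finset.sum_range_succ', Finset.mul_sum]; simp [pow_succ, mul_comm]

lemma key_partial (q : ℝ) (W v : ℕ → ℕ) (N : ℕ) (hv : Monotone v) (p : ℕ) (hp : p ≤ N) :
    ∑ s ∈ Finset.range (p + 1), q ^ GN W v N s = q ^ (majN W N + fN W v N p) * qint q (p + 1) := by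
  induction p with
  | zero => simp [GN_zero, qint]
  | succ p ih =>
    rw [Finset.sum_range_succ, ih (by omega)]
    have h1 := GN_succ W v N p (by omega)
    have h2 := fN_succ W v N p (by omega) (hv (by omega))
    have h3 : (if v (p + 1) ≤ W p then 1 else 0) + mN W v (p + 1) = dN W p ∨
       (if v (p + 1) ≤ W p then 1 else 0) + mN W v (p + 1) = dN W p + 1 := by
      unfold mN dN; split_ifs <;> omega
    rcases h3 with h3 | h3
    · rw [h3] at h1
      have h4 : fN W v N p = fN W v N (p + 1) + 1 := by omega
      have h5 : GN W v N (p + 1) = majN W N + fN W v N (p + 1) := by omega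
      rw [h4, h5, qint_succ' q (p + 1)]; ring
    · rw [h3, mul_add] at h1
      have h4 : fN W v N p = fN W v N (p + 1) := by omega
      have h5 : GN W v N (p + 1) = majN W N + fN W v N (p + 1) + (p + 1) := by omega
      rw [h4, h5, qint_succ q (p + 1)]; ring

lemma key_sum (q : ℝ) (W v : ℕ → ℕ) (N : ℕ) (hv : Monotone v) (hN : v N ≤ W N) :
    ∑ s ∈ Finset.range (N + 1), q ^ GN W v N s = q ^ majN W N * qint q (N + 1) := by
  rw [key_partial q W v N hv N le_rfl]
  have : fN W v N N = 0 := by simp [fN, mN, hN]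
  rw [this, add_zero]

/-- Insert `p ↦ v` into a permutation. -/
def insP {n : ℕ} (p v : Fin (n + 1)) (π : Equiv.Perm (Fin n)) : Equiv.Perm (Fin (n + 1)) :=
  (finSuccEquiv' p).trans ((Equiv.optionCongr π).trans (finSuccEquiv' v).symm)

lemma insP_self {n : ℕ} (p v : Fin (n + 1)) (π : Equiv.Perm (Fin n)) : insP p v π p = v := by
  simp [insP]

lemma insP_succAbove {n : ℕ} (p v : Fin (n + 1)) (π : Equiv.Perm (Fin n)) (i : Fin n) :
    insP p v π (p.succAbove i) = v.succAbove (π i) := by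
  simp [insP]

lemma insP_inj {n : ℕ} (p v : Fin (n + 1)) : Function.Injective (insP (n := n) p v) := by
  intro a b h
  ext i
  have := congrArg (fun e => e (p.succAbove i)) h
  simp only [insP_succAbove] at this
  rw [Fin.succAbove_right_injective this]

lemma insP_surj {n : ℕ} (p v : Fin (n + 1)) (σ : Equiv.Perm (Fin (n + 1))) (h : σ p = v) :
    ∃ π, insP p v π = σ := by
  have h' : ((finSuccEquiv' p).symm.trans (σ.trans (finSuccEquiv' v))) none = none := by simp [h]
  refine ⟨Equiv.removeNone ((finSuccEquiv' p).symm.trans (σ.trans (finSuccEquiv' v))), ?_⟩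
  unfold insP
  ext i
  rcases Fin.eq_self_or_eq_succAbove p i with rfl | ⟨j, rfl⟩
  · simp [h]
  · simp only [Equiv.trans_apply, finSuccEquiv'_succAbove, Equiv.optionCongr_apply, Option.map_some]
    have hs : ∃ x, ((finSuccEquiv' p).symm.trans (σ.trans (finSuccEquiv' v))) (some j) = some x := by
      rw [← Option.ne_none_iff_exists']
      intro hh
      rw [← h'] at hh
      simpa using (Equiv.injective _ hh)
    rw [Equiv.removeNone_some _ hs]
    simp

lemma sum_insP {n : ℕ} (p v : Fin (n + 1)) (F : Equiv.Perm (Fin (n + 1)) → ℝ) :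
    ∑ σ, (if σ p = v then F σ else 0) = ∑ π, F (insP p v π) := by
  rw [← Finset.sum_filter]
  symm
  apply Finset.sum_bij (fun π _ => insP p v π)
  · intro π _; simp [insP_self]
  · intro a _ b _ h; exact insP_inj p v h
  · intro σ hσ
    obtain ⟨π, h⟩ := insP_surj p v σ (by simpa using hσ)
    exact ⟨π, by simp, h⟩
  · intros; rfl

lemma ext_insP {n : ℕ} (p v : Fin (n + 1)) (π : Equiv.Perm (Fin n)) :
    extP (insP p v π) = insW (extP π) p v := by
  funext i
  have hv := v.2
  have hp := p.2
  by_cases hi : i < n + 1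
  · have h0 : extP (insP p v π) i = (insP p v π ⟨i, hi⟩ : ℕ) := by simp [extP, hi]
    rw [h0]
    generalize hI : (⟨i, hi⟩ : Fin (n + 1)) = I
    have hiI : i = I := by rw [← hI]
    rcases Fin.eq_self_or_eq_succAbove p I with rfl | ⟨j, rfl⟩
    · rw [insP_self, hiI]; simp [insW]
    · rw [insP_succAbove]
      have hE : extP π j = π j := by simp [extP]
      have hL : ((v.succAbove (π j) : Fin (n+1)) : ℕ) = liftN v (π j) := by
        unfold liftN Fin.succAbove
        simp only [Fin.lt_def, Fin.val_castSucc]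
        split_ifs <;> simp
      rw [hL, ← hE]
      by_cases hj : (j : ℕ) < p
      · have : i = j := by
          rw [hiI, Fin.succAbove_of_castSucc_lt _ _ (by simpa [Fin.lt_def] using hj)]; simp
        rw [this, insW, if_pos hj]
      · have : i = j + 1 := by
          rw [hiI, Fin.succAbove_of_le_castSucc _ _ (by simpa [Fin.le_def] using hj)]; simp
        rw [this, insW, if_neg (by omega), if_neg (by omega)]; rfl
  · unfold insW
    rw [if_neg (by omega), if_neg (by omega)]
    have h1 : extP π (i - 1) = i - 1 := by unfold extP; rw [dif_neg (by omega)]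
    rw [h1]
    unfold extP liftN
    rw [dif_neg hi, if_neg (by omega)]; omega

lemma maj_insP {n : ℕ} (p v : Fin (n + 1)) (π : Equiv.Perm (Fin n)) :
    maj (insP p v π) = majN (insW (extP π) p v) (n + 1) := by
  rw [maj_eq_s15, ext_insP]

lemma macmahon (q : ℝ) (n : ℕ) : ∑ π : Equiv.Perm (Fin n), q ^ maj π = qfact q n := by
  induction n with
  | zero => simp [qfact, maj, wmaj]
  | succ n ih =>
    have h1 : ∀ σ : Equiv.Perm (Fin (n + 1)),
        q ^ maj σ = ∑ p, if σ p = Fin.last n then q ^ maj σ else 0 := by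
      intro σ
      rw [Finset.sum_eq_single (σ.symm (Fin.last n))]
      · simp
      · intro b _ hb
        rw [if_neg]
        intro h; apply hb; rw [← h]; simp
      · simp
    rw [Finset.sum_congr rfl (fun σ _ => h1 σ), Finset.sum_comm]
    simp_rw [sum_insP]
    rw [Finset.sum_comm]
    have h2 : ∀ π : Equiv.Perm (Fin n), ∑ p, q ^ maj (insP p (Fin.last n) π) = q ^ maj π * qint q (n + 1) := by
      intro π
      rw [maj_eq_s15 π, ← key_sum q (extP π) (fun _ => n) n monotone_const (by simp [extP]), Finset.sum_range]
      apply Finset.sum_congr rfl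
      intro p _
      rw [maj_insP]
      unfold GN zN
      congr 1
      rw [Finset.sum_eq_zero]
      · simp
      · intro i _; rw [if_neg]; simp
    rw [Finset.sum_congr rfl (fun π _ => h2 π), ← Finset.sum_mul, ih]
    unfold qfact; rw [Finset.prod_range_succ]

lemma fix_insP {n : ℕ} (p : Fin (n + 1)) (π : Equiv.Perm (Fin n)) :
    fixedPointCount (insP p p π) = fixedPointCount π + 1 := by
  unfold fixedPointCount
  rw [Finset.card_filter, Finset.card_filter, Fin.sum_univ_succAbove _ p]
  simp only [insP_self, insP_succAbove, (Fin.succAbove_right_injective).eq_iff]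
  simp [add_comm]

/-- number of fixed points strictly after `p` -/
def fixAfter {n : ℕ} (σ : Equiv.Perm (Fin n)) (p : Fin n) : ℕ :=
  ((Finset.univ.filter (fun i : Fin n => σ i = i)).filter (fun i => p < i)).card

lemma fixAfter_insP {n : ℕ} (p : Fin (n + 1)) (π : Equiv.Perm (Fin n)) :
    fixAfter (insP p p π) p = ∑ i ∈ Finset.Ico (p : ℕ) n, zN (extP π) id i := by
  unfold fixAfter
  rw [Finset.filter_filter, Finset.card_filter, Fin.sum_univ_succAbove _ p]
  simp only [insP_self, insP_succAbove, (Fin.succAbove_right_injective).eq_iff]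
  have : ∑ i ∈ Finset.Ico (p : ℕ) n, zN (extP π) id i
      = ∑ i ∈ Finset.range n, if (p : ℕ) ≤ i then zN (extP π) id i else 0 := by
    rw [← Finset.sum_filter]
    apply Finset.sum_congr _ (fun _ _ => rfl)
    ext i; simp; omega
  rw [this, Finset.sum_range]
  simp only [lt_irrefl, and_false, if_false, zero_add]
  apply Finset.sum_congr rfl
  intro i _
  have h1 : p < p.succAbove i ↔ (p : ℕ) ≤ i := by
    rw [Fin.lt_succAbove_iff_le_castSucc]; simp [Fin.le_def]
  have h2 : zN (extP π) id i = if π i = i then 1 else 0 := by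
    simp only [zN, extP, id, i.2, dif_pos, Fin.ext_iff]
    have : (i : ℕ) ≤ (π i : ℕ) ∧ (π i : ℕ) < i + 1 ↔ (π i : ℕ) = i := by omega
    exact if_congr this rfl rfl
  rw [h2]
  simp only [h1]
  by_cases hh : (p : ℕ) ≤ i <;> simp [hh]

lemma sum_rank (q : ℝ) {n : ℕ} (s : Finset (Fin n)) :
    ∑ i ∈ s, q ^ (s.filter (fun j => i < j)).card = qint q s.card := by
  induction s using Finset.induction_on_min with
  | empty => simp [qint]
  | insert a s h ih =>
    have ha : a ∉ s := fun h' => lt_irrefl _ (h a h')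
    rw [Finset.sum_insert ha, Finset.card_insert_of_notMem ha, qint_succ, ← ih, add_comm]
    congr 1
    · apply Finset.sum_congr rfl
      intro i hi
      rw [Finset.filter_insert, if_neg (not_lt.2 (h i hi).le)]
    · rw [Finset.filter_insert, if_neg (lt_irrefl _), Finset.filter_true_of_mem h]

noncomputable def MM (q : ℝ) (n : ℕ) (g : ℕ → ℝ) : ℝ :=
  ∑ π : Equiv.Perm (Fin n), q ^ maj π * g (fixedPointCount π)

lemma MM_succ (q : ℝ) (n : ℕ) (g : ℕ → ℝ) :
    MM q (n + 1) (fun k => qint q k * g k) = qint q (n + 1) * MM q n (fun k => g (k + 1)) := by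
  unfold MM
  have h1 : ∀ σ : Equiv.Perm (Fin (n + 1)),
      q ^ maj σ * (qint q (fixedPointCount σ) * g (fixedPointCount σ))
       = ∑ p, if σ p = p then q ^ (maj σ + fixAfter σ p) * g (fixedPointCount σ) else 0 := by
    intro σ
    rw [← Finset.sum_filter, ← Finset.sum_mul]
    simp_rw [pow_add]
    rw [← Finset.mul_sum]
    unfold fixAfter
    rw [sum_rank]
    unfold fixedPointCount
    ring
  rw [Finset.sum_congr rfl (fun σ _ => h1 σ), Finset.sum_comm]
  simp_rw [sum_insP, fix_insP]
  rw [Finset.sum_comm, Finset.mul_sum]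
  apply Finset.sum_congr rfl
  intro π _
  rw [← Finset.sum_mul, ← mul_assoc]
  congr 1
  rw [mul_comm, maj_eq_s15 π, ← key_sum q (extP π) id n monotone_id (by simp [extP]), Finset.sum_range]
  apply Finset.sum_congr rfl
  intro p _
  rw [maj_insP, fixAfter_insP]
  rfl

/-- The `q`-binomial coefficient via the `q`-Pascal rule. -/
noncomputable def qb (q : ℝ) : ℕ → ℕ → ℝ
  | _, 0 => 1
  | 0, _ + 1 => 0
  | k + 1, j + 1 => qb q k j + q ^ (j + 1) * qb q k (j + 1)

lemma qb_zero (q : ℝ) (k : ℕ) : qb q k 0 = 1 := by cases k <;> rfl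

lemma qb_succ (q : ℝ) (k j : ℕ) :
    qb q (k + 1) (j + 1) = qb q k j + q ^ (j + 1) * qb q k (j + 1) := rfl

lemma qb_eq_zero (q : ℝ) (k : ℕ) : ∀ j, k < j → qb q k j = 0 := by
  induction k with
  | zero => intro j hj; obtain ⟨j, rfl⟩ : ∃ i, j = i + 1 := ⟨j - 1, by omega⟩; rfl
  | succ k ih =>
    intro j hj
    obtain ⟨j, rfl⟩ : ∃ i, j = i + 1 := ⟨j - 1, by omega⟩
    rw [qb_succ, ih _ (by omega), ih _ (by omega)]; ring

lemma qb_absorb (q : ℝ) (k : ℕ) : ∀ j,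
    qint q (j + 1) * qb q (k + 1) (j + 1) = qint q (k + 1) * qb q k j := by
  induction k with
  | zero =>
    intro j
    cases j with
    | zero => simp [qb, qint]
    | succ j => simp [qb, qb_succ]
  | succ k ih =>
    intro j
    rw [qb_succ, mul_add, mul_left_comm, ih j]
    cases j with
    | zero => simp only [qb_zero]; rw [qint_succ' q (k + 1)]; simp [qint]; ring
    | succ j =>
      have h1 := ih j
      have h2 := qb_succ q k j
      rw [qint_succ' q (k + 1), qint_succ' q (j + 1)]
      linear_combination q * h1 - q * qint q (k + 1) * h2

noncomputable def SS (q : ℝ) (x : ℕ → ℝ) (k : ℕ) : ℝ :=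
  ∑ j ∈ Finset.range (k + 1), qb q k j * x j

lemma SS_succ (q : ℝ) (x y : ℕ → ℝ) (h : ∀ j, x (j + 1) + q ^ j * x j = x j + y j) (k : ℕ) :
    SS q x (k + 1) = SS q x k + SS q y k := by
  unfold SS
  rw [Finset.sum_range_succ']
  simp only [qb_succ, add_mul, Finset.sum_add_distrib]
  have h1 : (∑ j ∈ Finset.range (k + 1), q ^ (j + 1) * qb q k (j + 1) * x (j + 1)) + qb q (k + 1) 0 * x 0
      = ∑ j ∈ Finset.range (k + 1), q ^ j * qb q k j * x j := by
    have := Finset.sum_range_succ' (fun j => q ^ j * qb q k j * x j) (k + 1)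
    rw [Finset.sum_range_succ, qb_eq_zero q k (k + 1) (by omega)] at this
    simp only [qb_zero] at this ⊢
    simp only [mul_zero, zero_mul, add_zero, pow_zero, mul_one] at this
    exact this.symm
  rw [add_assoc, h1, ← Finset.sum_add_distrib, ← Finset.sum_add_distrib]
  apply Finset.sum_congr rfl
  intro j _
  linear_combination qb q k j * h j

noncomputable def p1 (q : ℝ) : ℕ → ℝ
  | 0 => 0
  | j + 1 => (1 - q ^ j) * p1 q j + if j = 0 then 1 else 0

noncomputable def p2 (q : ℝ) : ℕ → ℝ
  | 0 => 0
  | j + 1 => (1 - q ^ j) * p2 q j + p1 q j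

lemma SS_p1 (q : ℝ) (k : ℕ) : SS q (p1 q) k = k := by
  induction k with
  | zero => simp [SS, p1]
  | succ k ih =>
    rw [SS_succ q (p1 q) (fun j => if j = 0 then 1 else 0) (by intro j; rw [p1]; ring), ih]
    simp [SS, qb_zero]

lemma SS_p2 (q : ℝ) (k : ℕ) : SS q (p2 q) k = k * (k - 1) / 2 := by
  induction k with
  | zero => simp [SS, p2]
  | succ k ih =>
    rw [SS_succ q (p2 q) (p1 q) (by intro j; rw [p2]; ring), ih, SS_p1]
    push_cast; ring

lemma qint_pos (q : ℝ) (hq : 0 < q) (m : ℕ) : 1 ≤ qint q (m + 1) := by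
  rw [qint_succ']
  have : 0 ≤ qint q m := Finset.sum_nonneg (fun i _ => by positivity)
  nlinarith

lemma qfact_pos_s15 (q : ℝ) (hq : 0 < q) (n : ℕ) : 0 < qfact q n :=
  Finset.prod_pos (fun i _ => by linarith [qint_pos q hq i])

lemma qfact_succ (q : ℝ) (n : ℕ) : qfact q (n + 1) = qfact q n * qint q (n + 1) := by
  unfold qfact; rw [Finset.prod_range_succ]

lemma MM_qb (q : ℝ) (hq : 0 < q) (n : ℕ) : ∀ j, j ≤ n →
    MM q n (fun k => qb q k j) = qfact q n / qfact q j := by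
  induction n with
  | zero =>
    intro j hj
    obtain rfl : j = 0 := by omega
    simp [MM, qb_zero, macmahon, qfact, ← macmahon, maj, wmaj]
  | succ n ih =>
    intro j hj
    cases j with
    | zero =>
      have : qfact q 0 = 1 := by simp [qfact]
      simp only [MM, qb_zero, mul_one, macmahon, this, div_one]
    | succ j =>
      have hj0 : qint q (j + 1) ≠ 0 := by linarith [qint_pos q hq j]
      have hf := (qfact_pos_s15 q hq j).ne'
      have h1 : (fun k => qb q k (j + 1)) = fun k => qint q k * (qb q (k - 1) j / qint q (j + 1)) := by
        funext k
        cases k with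
        | zero => simp [qint, qb]
        | succ k =>
          have := qb_absorb q k j
          simp only [Nat.add_sub_cancel]
          field_simp
          linarith
      rw [h1, MM_succ]
      simp only [Nat.add_sub_cancel]
      have h2 : MM q n (fun k => qb q k j / qint q (j + 1)) = MM q n (fun k => qb q k j) / qint q (j + 1) := by
        unfold MM; rw [Finset.sum_div]; apply Finset.sum_congr rfl; intros; ring
      rw [h2, ih j (by omega), qfact_succ, qfact_succ]
      field_simp

lemma fix_le {n : ℕ} (π : Equiv.Perm (Fin n)) : fixedPointCount π ≤ n := by
  unfold fixedPointCount
  exact (Finset.card_le_univ _).trans (by simp)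

lemma majExp_SS (q : ℝ) (hq : 0 < q) (n : ℕ) (x : ℕ → ℝ) :
    majExp q n (fun π => SS q x (fixedPointCount π)) = ∑ j ∈ Finset.range (n + 1), x j / qfact q j := by
  have h1 : ∀ π : Equiv.Perm (Fin n), SS q x (fixedPointCount π)
      = ∑ j ∈ Finset.range (n + 1), qb q (fixedPointCount π) j * x j := by
    intro π
    have := fix_le π
    unfold SS
    apply Finset.sum_subset
    · intro i; simp; omega
    · intro i _ hi
      rw [qb_eq_zero q _ i (by simpa using hi), zero_mul]
  unfold majExp
  simp only [h1, Finset.sum_mul]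
  rw [Finset.sum_comm]
  apply Finset.sum_congr rfl
  intro j hj
  have hj : j ≤ n := by simpa [Nat.lt_succ_iff] using hj
  have h2 := MM_qb q hq n j hj
  unfold MM at h2
  have hn := (qfact_pos_s15 q hq n).ne'
  calc _ = (∑ π : Equiv.Perm (Fin n), q ^ maj π * qb q (fixedPointCount π) j) * (x j / qfact q n) := by
        rw [Finset.sum_mul]; apply Finset.sum_congr rfl; intros; ring
    _ = _ := by rw [h2]; field_simp

noncomputable def aa (q : ℝ) (m : ℕ) : ℝ := (1 - q) ^ m / qint q (m + 1)

lemma one_sub_pow (q : ℝ) (m : ℕ) : 1 - q ^ m = (1 - q) * qint q m := by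
  unfold qint; rw [mul_neg_geom_sum]

lemma alpha_eq (q : ℝ) (hq : 0 < q) (m : ℕ) : p1 q (m + 1) / qfact q (m + 1) = aa q m := by
  unfold aa
  have hm := qint_pos q hq m
  have hf := qfact_pos_s15 q hq m
  induction m with
  | zero => simp [p1, qfact, qint]
  | succ m ih =>
    have hm' := qint_pos q hq m
    have hf' := qfact_pos_s15 q hq m
    have ih := ih hm' hf'
    rw [p1, if_neg (by omega), add_zero, qfact_succ, one_sub_pow]
    have hm0 : qint q (m + 1) ≠ 0 := by linarith
    have : (1 - q) * qint q (m + 1) * p1 q (m + 1) / (qfact q (m + 1) * qint q (m + 1 + 1))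
      = (1 - q) * qint q (m + 1) / qint q (m + 1 + 1) * (p1 q (m + 1) / qfact q (m + 1)) := by
      field_simp
    rw [this, ih, pow_succ]
    field_simp

lemma beta_eq (q : ℝ) (hq : 0 < q) (hq1 : q < 1) (m : ℕ) :
    p2 q (m + 1) / qfact q (m + 1) = aa q m * ∑ i ∈ Finset.range m, 1 / (1 - q ^ (i + 1)) := by
  induction m with
  | zero => simp [p2, p1]
  | succ m ih =>
    have hm := qint_pos q hq m
    have hm1 := qint_pos q hq (m + 1)
    have hf := qfact_pos_s15 q hq (m + 1)
    have hm0 : qint q (m + 1) ≠ 0 := by linarith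
    have hm10 : qint q (m + 1 + 1) ≠ 0 := by linarith
    have hq' : 1 - q ≠ 0 := by linarith
    rw [p2, qfact_succ, Finset.sum_range_succ]
    have h1 : ((1 - q ^ (m + 1)) * p2 q (m + 1) + p1 q (m + 1)) / (qfact q (m + 1) * qint q (m + 1 + 1))
      = ((1 - q ^ (m + 1)) * (p2 q (m + 1) / qfact q (m + 1)) + p1 q (m + 1) / qfact q (m + 1)) / qint q (m + 1 + 1) := by
      field_simp
    have h2 : aa q (m + 1) = (1 - q ^ (m + 1)) * aa q m / qint q (m + 1 + 1) := by
      unfold aa; rw [one_sub_pow, pow_succ]; field_simp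
    have h3 : 1 - q ^ (m + 1) ≠ 0 := by rw [one_sub_pow]; exact mul_ne_zero hq' hm0
    rw [h1, ih, alpha_eq q hq, h2]
    field_simp

lemma beta_conv (q : ℝ) (hq : 0 < q) (hq1 : q < 1) (m : ℕ) :
    2 * (p2 q (m + 2) / qfact q (m + 2)) =
      (∑ x ∈ Finset.HasAntidiagonal.antidiagonal m, aa q x.1 * aa q x.2) + (m + 1 : ℝ) * aa q (m + 1) := by
  rw [beta_eq q hq hq1 (m + 1)]
  have h0 : ∀ i : ℕ, 1 - q ^ (i + 1) ≠ 0 := by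
    intro i
    have := pow_lt_one₀ hq.le hq1 (Nat.succ_ne_zero i)
    simp only [Nat.succ_eq_add_one] at this
    linarith
  have ha : ∀ i, aa q i = (1 - q) ^ (i + 1) / (1 - q ^ (i + 1)) := by
    intro i
    unfold aa
    have hm := qint_pos q hq i
    have hm0 : qint q (i + 1) ≠ 0 := by linarith
    have hq' : 1 - q ≠ 0 := by linarith
    rw [one_sub_pow, pow_succ]; field_simp
  have h1 : ∀ x ∈ Finset.HasAntidiagonal.antidiagonal m, aa q x.1 * aa q x.2 =
      aa q (m + 1) * (1 / (1 - q ^ (x.1 + 1))) + aa q (m + 1) * (1 / (1 - q ^ (x.2 + 1))) - aa q (m + 1) := by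
    rintro ⟨i, l⟩ hx
    have hx : i + l = m := by simpa using hx
    subst hx
    have h1 := h0 i
    have h2 := h0 l
    have h3 := h0 (i + l + 1)
    simp only [ha]
    have e1 : q ^ (i + l + 1 + 1) = q ^ (i + 1) * q ^ (l + 1) := by ring
    have e2 : (1 - q) ^ (i + l + 1 + 1) = (1 - q) ^ (i + 1) * (1 - q) ^ (l + 1) := by ring
    rw [e1] at h3
    rw [e1, e2]
    generalize q ^ (i + 1) = A at *
    generalize q ^ (l + 1) = B at *
    generalize (1 - q) ^ (i + 1) = C at *
    generalize (1 - q) ^ (l + 1) = D at *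
    field_simp
    ring
  rw [Finset.sum_congr rfl h1, Finset.sum_sub_distrib, Finset.sum_add_distrib,
    ← Finset.mul_sum, ← Finset.mul_sum]
  have h2 : ∑ x ∈ Finset.HasAntidiagonal.antidiagonal m, 1 / (1 - q ^ (x.1 + 1)) = ∑ i ∈ Finset.range (m + 1), 1 / (1 - q ^ (i + 1)) :=
    Finset.Nat.sum_antidiagonal_eq_sum_range_succ_mk (fun x => 1 / (1 - q ^ (x.1 + 1))) m
  have h3 : ∑ x ∈ Finset.HasAntidiagonal.antidiagonal m, 1 / (1 - q ^ (x.2 + 1)) = ∑ x ∈ Finset.HasAntidiagonal.antidiagonal m, 1 / (1 - q ^ (x.1 + 1)) :=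
    Finset.Nat.sum_antidiagonal_swap (f := fun x => 1 / (1 - q ^ (x.1 + 1)))
  rw [h3, h2]
  simp
  ring

lemma mean_eq (q : ℝ) (hq : 0 < q) (n : ℕ) :
    majExp q n (fun π => (fixedPointCount π : ℝ)) = ∑ m ∈ Finset.range n, aa q m := by
  have := majExp_SS q hq n (p1 q)
  simp only [SS_p1] at this
  rw [this, Finset.sum_range_succ']
  simp only [alpha_eq q hq]
  simp [p1]

lemma second_eq (q : ℝ) (hq : 0 < q) (hq1 : q < 1) (n : ℕ) :
    majExp q (n + 2) (fun π => (fixedPointCount π : ℝ) ^ 2) =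
      (∑ m ∈ Finset.range (n + 1), ∑ x ∈ Finset.HasAntidiagonal.antidiagonal m, aa q x.1 * aa q x.2)
       + ∑ m ∈ Finset.range (n + 2), (m + 1 : ℝ) * aa q m := by
  have h1 := majExp_SS q hq (n + 2) (p2 q)
  simp only [SS_p2] at h1
  have h2 : majExp q (n + 2) (fun π => (fixedPointCount π : ℝ) ^ 2) =
     2 * majExp q (n + 2) (fun π => (fixedPointCount π : ℝ) * (fixedPointCount π - 1) / 2)
      + majExp q (n + 2) (fun π => (fixedPointCount π : ℝ)) := by
    unfold majExp
    rw [Finset.mul_sum, ← Finset.sum_add_distrib]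
    apply Finset.sum_congr rfl; intros; ring
  rw [h2, h1, mean_eq q hq, Finset.sum_range_succ', Finset.sum_range_succ', mul_add, mul_add, Finset.mul_sum]
  simp only [add_assoc, one_add_one_eq_two, beta_conv q hq hq1]
  rw [Finset.sum_add_distrib]
  have h3 : ∑ m ∈ Finset.range (n + 2), (m + 1 : ℝ) * aa q m
      = (∑ m ∈ Finset.range (n + 1), (m + 1 : ℝ) * aa q (m + 1)) + ∑ m ∈ Finset.range (n + 2), aa q m := by
    simp only [add_mul, Finset.sum_add_distrib, one_mul]
    rw [Finset.sum_range_succ' (fun m : ℕ => (m : ℝ) * aa q m)]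
    simp [add_mul, Finset.sum_add_distrib]
  rw [h3]
  simp [p2, p1]
  ring

lemma summable_aa' (q : ℝ) (hq0 : 0 < q) (hq1 : q < 1) :
    Summable (fun m : ℕ => ((m : ℝ) + 1) * aa q m) := by
  have hb : Summable (fun m : ℕ => ((m : ℝ) + 1) * (1 - q) ^ m) := by
    have hn : ‖(1 - q : ℝ)‖ < 1 := by rw [Real.norm_eq_abs, abs_lt]; constructor <;> linarith
    have h1 := summable_pow_mul_geometric_of_norm_lt_one 1 hn
    have h2 := summable_geometric_of_norm_lt_one hn
    simpa [add_mul] using h1.add h2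
  have h1q : 0 ≤ 1 - q := by linarith
  refine Summable.of_nonneg_of_le (fun m => ?_) (fun m => ?_) hb
  · have := qint_pos q hq0 m
    unfold aa; positivity
  · have := qint_pos q hq0 m
    unfold aa
    gcongr
    exact div_le_self (by positivity) this

lemma aa_nonneg (q : ℝ) (hq0 : 0 < q) (hq1 : q < 1) (m : ℕ) : 0 ≤ aa q m := by
  have := qint_pos q hq0 m
  have h1q : 0 ≤ 1 - q := by linarith
  unfold aa; positivity

/-- The variance of the number of fixed points under `Maj(n,q)` converges, as
`n → ∞`, to `∑_{ℓ ≥ 1} ℓ (1-q)^{ℓ-1} / [ℓ]_q` (indexing `ℓ = m + 1`). -/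
theorem fixed_points_variance_limit (q : ℝ) (hq0 : 0 < q) (hq1 : q < 1) :
    Tendsto (fun n : ℕ =>
        majExp q n (fun π => ((fixedPointCount π : ℝ)) ^ 2)
          - (majExp q n (fun π => (fixedPointCount π : ℝ))) ^ 2)
      atTop
      (nhds (∑' m : ℕ, ((m + 1 : ℕ) : ℝ) * (1 - q) ^ m / qint q (m + 1))) := by
  have hs' := summable_aa' q hq0 hq1
  have hs : Summable (aa q) := by
    refine Summable.of_nonneg_of_le (aa_nonneg q hq0 hq1) (fun m => ?_) hs'
    have := aa_nonneg q hq0 hq1 m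
    nlinarith [(Nat.cast_nonneg m : (0 : ℝ) ≤ m)]
  have hn : Summable (fun m => ‖aa q m‖) := hs.norm
  have hc : Summable (fun m => ∑ x ∈ Finset.HasAntidiagonal.antidiagonal m, aa q x.1 * aa q x.2) :=
    (summable_norm_sum_mul_antidiagonal_of_summable_norm hn hn).of_norm
  have hce := tsum_mul_tsum_eq_tsum_sum_antidiagonal_of_summable_norm hn hn
  rw [← tendsto_add_atTop_iff_nat 2]
  have e1 : ∀ n : ℕ, majExp q (n + 2) (fun π => ((fixedPointCount π : ℝ)) ^ 2)
          - (majExp q (n + 2) (fun π => (fixedPointCount π : ℝ))) ^ 2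
      = (∑ m ∈ Finset.range (n + 1), ∑ x ∈ Finset.HasAntidiagonal.antidiagonal m, aa q x.1 * aa q x.2)
       + (∑ m ∈ Finset.range (n + 2), (m + 1 : ℝ) * aa q m)
       - (∑ m ∈ Finset.range (n + 2), aa q m) ^ 2 := by
    intro n
    rw [second_eq q hq0 hq1, mean_eq q hq0]
  simp only [e1]
  have t1 := (tendsto_add_atTop_iff_nat 1).2 hc.hasSum.tendsto_sum_nat
  have t2 := (tendsto_add_atTop_iff_nat 2).2 hs'.hasSum.tendsto_sum_nat
  have t3 := (tendsto_add_atTop_iff_nat 2).2 hs.hasSum.tendsto_sum_nat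
  have := (t1.add t2).sub (t3.pow 2)
  rw [← hce] at this
  convert this using 2
  rw [sq, add_sub_cancel_left]
  apply tsum_congr
  intro m
  unfold aa
  push_cast
  ring
end
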